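/- arXiv:1707.04989 — 10 statements merged into one kernel-verified Lean document; each statement's English description precedes it below -/
import Mathlib

section
/- Let n ≥ 1, let m_1,…,m_n be real numbers, and let x_1,…,x_n be pairwise distinct real numbers. Define h(x) = Σ_{i,k=1}^n m_i m_k e^{−|x_i−x_k|}. Then for every j with 1 ≤ j ≤ n, the Poisson bracket satisfies {x_j, h}(x) = 2 Σ_{k≠j} m_j m_k e^{−|x_j−x_k|} + Σ_{i≠j, k≠j} m_i m_k (1 − sgn(x_j−x_k) sgn(x_j−x_i)) e^{−|x_j−x_k| − |x_j−x_i|}. (Here the coordinate function x_j is the function x ↦ x_j.) -/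
open scoped Classical
open Finset

/-- The Poisson bracket `{f,g}(x) = ∑_{i<k} sgn(x_i - x_k)
(∂f/∂x_i ∂g/∂x_k - ∂f/∂x_k ∂g/∂x_i)` on `ℝ^n`. -/
noncomputable def pb {n : ℕ} (f g : (Fin n → ℝ) → ℝ) (x : Fin n → ℝ) : ℝ :=
  ∑ i : Fin n, ∑ k : Fin n,
    if i < k then
      Real.sign (x i - x k) *
        (fderiv ℝ f x (Pi.single i 1) * fderiv ℝ g x (Pi.single k 1) -
         fderiv ℝ f x (Pi.single k 1) * fderiv ℝ g x (Pi.single i 1))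
    else 0

/-- The derivative of one summand `c * exp (-|y a - y b|)`, also valid on the diagonal. -/
theorem hasFDerivAt_mul_exp_neg_abs_sub {n : ℕ} (c : ℝ) {x : Fin n → ℝ}
    (hx : Function.Injective x) (a b : Fin n) :
    HasFDerivAt (fun y : Fin n → ℝ => c * Real.exp (-|y a - y b|))
      ((-(c * Real.exp (-|x a - x b|) * Real.sign (x a - x b))) •
        (ContinuousLinearMap.proj (R := ℝ) (φ := fun _ : Fin n => ℝ) a -
          ContinuousLinearMap.proj b)) x := by
  rcases eq_or_ne a b with rfl | hab
  · simpa using hasFDerivAt_const (c * Real.exp 0) x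
  have hne : x a - x b ≠ 0 := sub_ne_zero.mpr (hx.ne hab)
  have hsub : HasFDerivAt (fun y : Fin n → ℝ => y a - y b)
      (ContinuousLinearMap.proj (R := ℝ) (φ := fun _ : Fin n => ℝ) a -
        ContinuousLinearMap.proj b) x :=
    (hasFDerivAt_apply a x).sub (hasFDerivAt_apply b x)
  have habs : HasDerivAt (fun t : ℝ => |t|) (Real.sign (x a - x b)) (x a - x b) := by
    rcases hne.lt_or_gt with h | h
    · rw [Real.sign_of_neg h]; exact hasDerivAt_abs_neg h
    · rw [Real.sign_of_pos h]; exact hasDerivAt_abs_pos h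
  have hexp : HasDerivAt (fun t : ℝ => c * Real.exp (-|t|))
      (-(c * Real.exp (-|x a - x b|) * Real.sign (x a - x b))) (x a - x b) :=
    (habs.fun_neg.exp.const_mul c).congr_deriv (by ring)
  exact hexp.comp_hasFDerivAt (f := fun y : Fin n → ℝ => y a - y b) x hsub

theorem fderiv_sum_mul_exp_neg_abs_sub {n : ℕ} (m : Fin n → ℝ) {x : Fin n → ℝ}
    (hx : Function.Injective x) (v : Fin n → ℝ) :
    fderiv ℝ (fun y : Fin n → ℝ =>
        ∑ i : Fin n, ∑ k : Fin n, m i * m k * Real.exp (-|y i - y k|)) x v =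
      ∑ a : Fin n, ∑ b : Fin n,
        -(m a * m b * Real.exp (-|x a - x b|) * Real.sign (x a - x b)) * (v a - v b) := by
  have h := HasFDerivAt.fun_sum (u := Finset.univ) fun a _ =>
    HasFDerivAt.fun_sum (u := Finset.univ) fun b _ =>
      hasFDerivAt_mul_exp_neg_abs_sub (m a * m b) hx a b
  rw [h.fderiv]
  simp

/-- The bracket of a coordinate with `g` is the derivative of `g` in the direction
`k ↦ sgn (x j - x k)`. -/
theorem pb_coord_left {n : ℕ} (g : (Fin n → ℝ) → ℝ) (x : Fin n → ℝ) (j : Fin n) :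
    pb (fun y => y j) g x = fderiv ℝ g x fun k => Real.sign (x j - x k) := by
  have hf (v : Fin n → ℝ) : fderiv ℝ (fun y : Fin n → ℝ => y j) x v = v j := by
    rw [(hasFDerivAt_apply j x).fderiv]; rfl
  have hv : (fun k => Real.sign (x j - x k)) =
      ∑ k, Real.sign (x j - x k) • (Pi.single k 1 : Fin n → ℝ) :=
    (pi_eq_sum_univ' _).trans (Finset.sum_congr rfl fun k _ => by congr 1)
  rw [hv, map_sum]
  simp only [map_smul, smul_eq_mul, pb, hf]
  set D : Fin n → ℝ := fun k => fderiv ℝ g x (Pi.single k 1)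
  have hsplit (i k : Fin n) :
      (if i < k then Real.sign (x i - x k) *
        ((Pi.single i 1 : Fin n → ℝ) j * D k - (Pi.single k 1 : Fin n → ℝ) j * D i) else 0) =
      (if j = i then (if j < k then Real.sign (x j - x k) * D k else 0) else 0) +
      (if j = k then (if i < j then Real.sign (x j - x i) * D i else 0) else 0) := by
    have hs : Real.sign (x i - x k) = -Real.sign (x k - x i) := by
      rw [← Real.sign_neg, neg_sub]
    simp only [Pi.single_apply]
    by_cases hi : j = i <;> by_cases hk : j = k
    · subst hi; subst hk; simp
    · subst hi; simp [hk]
    · subst hk; simp [hi, hs]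
    · simp [hi, hk]
  change (∑ i, ∑ k, if i < k then Real.sign (x i - x k) *
        ((Pi.single i 1 : Fin n → ℝ) j * D k - (Pi.single k 1 : Fin n → ℝ) j * D i) else 0) =
      ∑ k, Real.sign (x j - x k) * D k
  simp only [hsplit, Finset.sum_add_distrib]
  rw [Finset.sum_comm]
  simp only [Finset.sum_ite_eq, Finset.mem_univ, if_true]
  rw [← Finset.sum_add_distrib]
  refine Finset.sum_congr rfl fun k _ => ?_
  rcases lt_trichotomy j k with h | rfl | h
  · simp [h, h.not_gt]
  · simp
  · simp [h, h.not_gt]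

/-- If `r` lies between `s` and `t` then `|s - t|` splits at `r`; otherwise both sides vanish. -/
theorem exp_neg_abs_mul_sign_mul_sign_sub {r s t : ℝ} (h : r ≠ s ∨ r ≠ t) :
    -(Real.exp (-|s - t|) * Real.sign (s - t)) * (Real.sign (r - s) - Real.sign (r - t)) =
      (1 - Real.sign (r - t) * Real.sign (r - s)) * Real.exp (-|r - t| - |r - s|) := by
  rcases lt_trichotomy r s with hs | rfl | hs <;> rcases lt_trichotomy r t with ht | rfl | ht
  · simp [Real.sign_of_neg (sub_neg.mpr hs), Real.sign_of_neg (sub_neg.mpr ht)]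
  · simp [Real.sign_of_neg (sub_neg.mpr hs), Real.sign_of_pos (sub_pos.mpr hs), abs_sub_comm]
  · rw [Real.sign_of_neg (sub_neg.mpr hs), Real.sign_of_pos (sub_pos.mpr ht),
      Real.sign_of_pos (sub_pos.mpr (ht.trans hs)), abs_of_pos (sub_pos.mpr (ht.trans hs)),
      abs_of_pos (sub_pos.mpr ht), abs_of_neg (sub_neg.mpr hs),
      show -(r - t) - -(r - s) = -(s - t) by ring]
    ring
  · simp [Real.sign_of_neg (sub_neg.mpr ht)]
  · simp at h
  · simp [Real.sign_of_pos (sub_pos.mpr ht)]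
  · rw [Real.sign_of_pos (sub_pos.mpr hs), Real.sign_of_neg (sub_neg.mpr ht),
      Real.sign_of_neg (sub_neg.mpr (hs.trans ht)), abs_of_neg (sub_neg.mpr (hs.trans ht)),
      abs_of_neg (sub_neg.mpr ht), abs_of_pos (sub_pos.mpr hs),
      show - -(r - t) - (r - s) = - -(s - t) by ring]
    ring
  · simp [Real.sign_of_neg (sub_neg.mpr hs), Real.sign_of_pos (sub_pos.mpr hs), abs_sub_comm]
  · simp [Real.sign_of_pos (sub_pos.mpr hs), Real.sign_of_pos (sub_pos.mpr ht)]

theorem statement0 (n : ℕ) (hn : 1 ≤ n) (m : Fin n → ℝ) (x : Fin n → ℝ)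
    (hx : Function.Injective x) (j : Fin n) :
    pb (fun y => y j)
      (fun y => ∑ i : Fin n, ∑ k : Fin n, m i * m k * Real.exp (-|y i - y k|)) x =
    2 * ∑ k ∈ Finset.univ.erase j, m j * m k * Real.exp (-|x j - x k|) +
      ∑ i ∈ Finset.univ.erase j, ∑ k ∈ Finset.univ.erase j,
        m i * m k * (1 - Real.sign (x j - x k) * Real.sign (x j - x i)) *
          Real.exp (-|x j - x k| - |x j - x i|) := by
  rw [pb_coord_left, fderiv_sum_mul_exp_neg_abs_sub m hx]
  set T : Fin n → Fin n → ℝ := fun a b =>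
    -(m a * m b * Real.exp (-|x a - x b|) * Real.sign (x a - x b)) *
      (Real.sign (x j - x a) - Real.sign (x j - x b)) with hT
  have hTeq (a b : Fin n) (h : j ≠ a ∨ j ≠ b) :
      T a b = m a * m b * (1 - Real.sign (x j - x b) * Real.sign (x j - x a)) *
        Real.exp (-|x j - x b| - |x j - x a|) := by
    have key := exp_neg_abs_mul_sign_mul_sign_sub (h.imp hx.ne hx.ne)
    simp only [hT]
    linear_combination m a * m b * key
  have hcol (a : Fin n) (ha : j ≠ a) : T a j = m j * m a * Real.exp (-|x j - x a|) := by
    rw [hTeq a j (Or.inl ha)]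
    simp [mul_comm (m a)]
  have hrow (b : Fin n) (hb : j ≠ b) : T j b = m j * m b * Real.exp (-|x j - x b|) := by
    rw [hTeq j b (Or.inr hb)]
    simp
  have hdiag : T j j = 0 := by simp [hT]
  have hsplit (f : Fin n → ℝ) : ∑ a, f a = f j + ∑ a ∈ Finset.univ.erase j, f a :=
    (Finset.add_sum_erase _ f (Finset.mem_univ j)).symm
  change ∑ a, ∑ b, T a b = _
  rw [hsplit, hsplit (T j), hdiag,
    Finset.sum_congr rfl fun b hb => hrow b (Finset.ne_of_mem_erase hb).symm,
    Finset.sum_congr rfl fun a _ => hsplit (T a), Finset.sum_add_distrib,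
    Finset.sum_congr rfl fun a ha => hcol a (Finset.ne_of_mem_erase ha).symm,
    Finset.sum_congr rfl fun a ha => Finset.sum_congr rfl fun b _ =>
      hTeq a b (Or.inl (Finset.ne_of_mem_erase ha).symm)]
  ring
end

section
/- Let K ≥ 1, let m_1,…,m_{2K} be real numbers, and let I, J be subsets of {1,…,K}. Define F(x) = Π_{p∈I} m_{2p−1} m_{2p} e^{x_{2p−1}−x_{2p}} and G(x) = Π_{q∈J} m_{2q−1} m_{2q} e^{x_{2q−1}−x_{2q}} as functions on ℝ^{2K}. Then {F, G}(x) = 0 at every point x with x_1 < x_2 < ⋯ < x_{2K}. -/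
open scoped Classical
open Finset

theorem two_mul_val_lt {K : ℕ} (p : Fin K) : 2 * p.val < 2 * K := by
  have := p.isLt
  omega

theorem two_mul_val_add_one_lt {K : ℕ} (p : Fin K) : 2 * p.val + 1 < 2 * K := by
  have := p.isLt
  omega

/-- A sum over `Fin (2 * K)` splits into sums over consecutive pairs of indices. -/
theorem sum_fin_two_mul {M : Type*} [AddCommMonoid M] (K : ℕ) (f : Fin (2 * K) → M) :
    ∑ i, f i = ∑ p : Fin K,
      (f ⟨2 * p.val, two_mul_val_lt p⟩ + f ⟨2 * p.val + 1, two_mul_val_add_one_lt p⟩) := by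
  induction K with
  | zero => simp
  | succ K ih =>
    rw [Fin.sum_univ_castSucc (n := K), ← add_assoc]
    change ∑ i : Fin (2 * K + 1 + 1), f i = _
    rw [Fin.sum_univ_castSucc, Fin.sum_univ_castSucc]
    rw [ih fun i => f i.castSucc.castSucc]
    rfl

/-- The increasing-order pairing of two vectors vanishes when both are antisymmetric within each
consecutive pair of indices. -/
theorem sum_lt_mul_sub_mul_eq_zero {R : Type*} [CommRing R] (K : ℕ) (a b : Fin (2 * K) → R)
    (ha : ∀ p : Fin K, a ⟨2 * p.val + 1, two_mul_val_add_one_lt p⟩ =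
      -a ⟨2 * p.val, two_mul_val_lt p⟩)
    (hb : ∀ p : Fin K, b ⟨2 * p.val + 1, two_mul_val_add_one_lt p⟩ =
      -b ⟨2 * p.val, two_mul_val_lt p⟩) :
    ∑ i, ∑ k, (if i < k then a i * b k - a k * b i else 0) = 0 := by
  rw [sum_fin_two_mul]
  refine Finset.sum_eq_zero fun p _ => ?_
  rw [← Finset.sum_add_distrib, sum_fin_two_mul]
  refine Finset.sum_eq_zero fun q _ => ?_
  simp only [Fin.mk_lt_mk, ha, hb]
  rcases lt_trichotomy p q with h | rfl | h
  · have h' : p.val < q.val := h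
    rw [if_pos (by omega), if_pos (by omega), if_pos (by omega), if_pos (by omega)]
    ring
  · rw [if_neg (by omega), if_neg (by omega), if_pos (by omega), if_neg (by omega)]
    ring
  · have h' : q.val < p.val := h
    rw [if_neg (by omega), if_neg (by omega), if_neg (by omega), if_neg (by omega)]
    ring

/-- On the chamber of increasing coordinates, the bracket vanishes for functions whose partial
derivatives are opposite within each consecutive pair of indices. -/
theorem pb_eq_zero_of_strictMono {K : ℕ} {f g : (Fin (2 * K) → ℝ) → ℝ} {x : Fin (2 * K) → ℝ}
    (hx : StrictMono x)
    (hf : ∀ p : Fin K, fderiv ℝ f x (Pi.single ⟨2 * p.val + 1, two_mul_val_add_one_lt p⟩ 1) =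
      -fderiv ℝ f x (Pi.single ⟨2 * p.val, two_mul_val_lt p⟩ 1))
    (hg : ∀ p : Fin K, fderiv ℝ g x (Pi.single ⟨2 * p.val + 1, two_mul_val_add_one_lt p⟩ 1) =
      -fderiv ℝ g x (Pi.single ⟨2 * p.val, two_mul_val_lt p⟩ 1)) :
    pb f g x = 0 := by
  have key := sum_lt_mul_sub_mul_eq_zero K (fun i => fderiv ℝ f x (Pi.single i 1))
    (fun i => fderiv ℝ g x (Pi.single i 1)) hf hg
  rw [← neg_eq_zero, ← key, pb]
  simp only [← Finset.sum_neg_distrib]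
  refine Finset.sum_congr rfl fun i _ => Finset.sum_congr rfl fun k _ => ?_
  split_ifs with h
  · rw [Real.sign_of_neg (sub_neg.mpr (hx h))]
    ring
  · exact neg_zero

/-- The partial derivatives of `∏ p ∈ I, c p * exp (y (2p) - y (2p+1))` are opposite within each
consecutive pair of indices. -/
theorem fderiv_prod_mul_exp_single (K : ℕ) (c : Fin K → ℝ) (I : Finset (Fin K))
    (x : Fin (2 * K) → ℝ) (q : Fin K) :
    fderiv ℝ (fun y : Fin (2 * K) → ℝ => ∏ p ∈ I, c p *
        Real.exp (y ⟨2 * p.val, two_mul_val_lt p⟩ -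
          y ⟨2 * p.val + 1, two_mul_val_add_one_lt p⟩)) x
        (Pi.single ⟨2 * q.val + 1, two_mul_val_add_one_lt q⟩ 1) =
      -fderiv ℝ (fun y : Fin (2 * K) → ℝ => ∏ p ∈ I, c p *
        Real.exp (y ⟨2 * p.val, two_mul_val_lt p⟩ -
          y ⟨2 * p.val + 1, two_mul_val_add_one_lt p⟩)) x
        (Pi.single ⟨2 * q.val, two_mul_val_lt q⟩ 1) := by
  have hd := HasFDerivAt.finsetProd (u := I) (x := x) fun p _ =>
    (((hasFDerivAt_apply (𝕜 := ℝ) (⟨2 * p.val, two_mul_val_lt p⟩ : Fin (2 * K)) x).sub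
      (hasFDerivAt_apply (⟨2 * p.val + 1, two_mul_val_add_one_lt p⟩ : Fin (2 * K)) x)).exp).const_mul
        (c p)
  have hd' := hd.fderiv
  simp only [Pi.sub_apply] at hd'
  rw [hd']
  simp only [_root_.sum_apply, _root_.smul_apply,
    _root_.sub_apply, ContinuousLinearMap.proj_apply, ← Finset.sum_neg_distrib]
  refine Finset.sum_congr rfl fun p _ => ?_
  have h₁ : 2 * p.val ≠ 2 * q.val + 1 := by omega
  have h₂ : 2 * p.val + 1 ≠ 2 * q.val := by omega
  simp [Pi.single_apply, h₁, h₂]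

/-- Indices are 0-based: the paper's `x_{2p-1}`, `x_{2p}`, `m_{2p-1}`, `m_{2p}`
(for `1 ≤ p ≤ K`) correspond to indices `2p` and `2p+1` for `p : Fin K`. -/
theorem statement4 (K : ℕ) (hK : 1 ≤ K) (m : Fin (2 * K) → ℝ)
    (I J : Finset (Fin K)) (x : Fin (2 * K) → ℝ) (hx : StrictMono x) :
    pb
      (fun y => ∏ p ∈ I,
        m ⟨2 * p.val, by have := p.isLt; omega⟩ * m ⟨2 * p.val + 1, by have := p.isLt; omega⟩ *
          Real.exp (y ⟨2 * p.val, by have := p.isLt; omega⟩ - y ⟨2 * p.val + 1, by have := p.isLt; omega⟩))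
      (fun y => ∏ q ∈ J,
        m ⟨2 * q.val, by have := q.isLt; omega⟩ * m ⟨2 * q.val + 1, by have := q.isLt; omega⟩ *
          Real.exp (y ⟨2 * q.val, by have := q.isLt; omega⟩ - y ⟨2 * q.val + 1, by have := q.isLt; omega⟩))
      x = 0 := by
  exact pb_eq_zero_of_strictMono hx
    (fderiv_prod_mul_exp_single K (fun p => m ⟨2 * p.val, two_mul_val_lt p⟩ *
      m ⟨2 * p.val + 1, two_mul_val_add_one_lt p⟩) I x)
    (fderiv_prod_mul_exp_single K (fun p => m ⟨2 * p.val, two_mul_val_lt p⟩ *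
      m ⟨2 * p.val + 1, two_mul_val_add_one_lt p⟩) J x)
end

section
/- Let K ≥ 1 and n = 2K, let m_1,…,m_n be positive real numbers, and for 1 ≤ j ≤ K define H_j on ℝ^n by H_j(x) = Σ_{I<J} (Π_{i∈I} m_i e^{x_i}) (Π_{k∈J} m_k e^{−x_k}), the sum running over pairs of j-element subsets I, J of {1,…,n} with I < J (interlacing). Then for all 1 ≤ i, j ≤ K, the Poisson bracket {H_i, H_j}(x) = 0 at every point x with x_1 < x_2 < ⋯ < x_n. -/
open scoped Classical
open Finset

/-- The `l`-th element (0-based) of a finset, in increasing order. -/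
def elt {n : ℕ} (I : Finset (Fin n)) (l : ℕ) (h : l < I.card) : Fin n :=
  I.orderEmbOfFin rfl ⟨l, h⟩

/-- `I < J` (interlacing): writing `I = {i₁ < i₂ < ⋯}` and `J = {j₁ < j₂ < ⋯}`,
we require `i₁ < j₁ < i₂ < j₂ < ⋯`. -/
def Interlaces {n : ℕ} (I J : Finset (Fin n)) : Prop :=
  (∀ l (hI : l < I.card) (hJ : l < J.card), elt I l hI < elt J l hJ) ∧
  (∀ l (hJ : l < J.card) (hI : l + 1 < I.card), elt J l hJ < elt I (l + 1) hI)

/-- `Hfun n j m x = H_j(x) = ∑_{I<J, |I|=|J|=j} (∏_{i∈I} mᵢ e^{xᵢ})(∏_{k∈J} mₖ e^{-xₖ})`. -/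
noncomputable def Hfun (n j : ℕ) (m : Fin n → ℝ) (x : Fin n → ℝ) : ℝ :=
  ∑ I : Finset (Fin n), ∑ J : Finset (Fin n),
    if I.card = j ∧ J.card = j ∧ Interlaces I J then
      (∏ i ∈ I, m i * Real.exp (x i)) * (∏ k ∈ J, m k * Real.exp (-x k))
    else 0

/-- The skew form `Ω(φ, ψ) = ∑_{i<k} (φᵢ ψₖ - φₖ ψᵢ)` on the dual of `ℝ^n`. -/
noncomputable def skewForm (n : ℕ) :
    ((Fin n → ℝ) →L[ℝ] ℝ) →ₗ[ℝ] ((Fin n → ℝ) →L[ℝ] ℝ) →ₗ[ℝ] ℝ :=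
  LinearMap.mk₂ ℝ (fun φ ψ => ∑ i : Fin n, ∑ k : Fin n,
      if i < k then φ (Pi.single i 1) * ψ (Pi.single k 1) -
        φ (Pi.single k 1) * ψ (Pi.single i 1) else 0)
    (fun φ φ' ψ => by
      simp only [← Finset.sum_add_distrib]
      refine Finset.sum_congr rfl fun i _ => Finset.sum_congr rfl fun k _ => ?_
      split_ifs <;> simp; ring)
    (fun c φ ψ => by
      simp only [Finset.smul_sum]
      refine Finset.sum_congr rfl fun i _ => Finset.sum_congr rfl fun k _ => ?_
      split_ifs <;> simp; ring)
    (fun φ ψ ψ' => by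
      simp only [← Finset.sum_add_distrib]
      refine Finset.sum_congr rfl fun i _ => Finset.sum_congr rfl fun k _ => ?_
      split_ifs <;> simp; ring)
    (fun c φ ψ => by
      simp only [Finset.smul_sum]
      refine Finset.sum_congr rfl fun i _ => Finset.sum_congr rfl fun k _ => ?_
      split_ifs <;> simp; ring)

lemma skewForm_apply {n : ℕ} (φ ψ : (Fin n → ℝ) →L[ℝ] ℝ) :
    skewForm n φ ψ = ∑ i : Fin n, ∑ k : Fin n,
      if i < k then φ (Pi.single i 1) * ψ (Pi.single k 1) -
        φ (Pi.single k 1) * ψ (Pi.single i 1) else 0 := rfl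

lemma skewForm_swap {n : ℕ} (φ ψ : (Fin n → ℝ) →L[ℝ] ℝ) :
    skewForm n φ ψ = -skewForm n ψ φ := by
  simp only [skewForm_apply, ← Finset.sum_neg_distrib]
  refine Finset.sum_congr rfl fun i _ => Finset.sum_congr rfl fun k _ => ?_
  split_ifs <;> ring

lemma skewForm_self {n : ℕ} (φ : (Fin n → ℝ) →L[ℝ] ℝ) : skewForm n φ φ = 0 := by
  linarith [skewForm_swap φ φ]

/-- The `k`-th coordinate functional on `ℝ^n`. -/
noncomputable def coordL {n : ℕ} (k : Fin n) : (Fin n → ℝ) →L[ℝ] ℝ :=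
  ContinuousLinearMap.proj k

lemma skewForm_coordL {n : ℕ} {k l : Fin n} (h : k < l) :
    skewForm n (coordL k) (coordL l) = 1 := by
  rw [skewForm_apply, Finset.sum_eq_single k, Finset.sum_eq_single l]
  · simp [coordL, h, h.ne, h.ne']
  · intro b _ hb
    simp [coordL, hb.symm, Pi.single_apply, h.ne']
  · simp
  · intro b _ hb
    refine Finset.sum_eq_zero fun c _ => ?_
    split_ifs with hbc
    · simp only [coordL, ContinuousLinearMap.proj_apply, Pi.single_apply]
      by_cases hlb : l = b
      · subst hlb
        have : k ≠ c := (h.trans hbc).ne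
        simp [this, hb.symm]
      · simp [hb.symm, hlb]
    · rfl
  · simp

lemma pb_eq_neg_skewForm {n : ℕ} (f g : (Fin n → ℝ) → ℝ) {x : Fin n → ℝ} (hx : StrictMono x) :
    pb f g x = -skewForm n (fderiv ℝ f x) (fderiv ℝ g x) := by
  simp only [pb, skewForm_apply, ← Finset.sum_neg_distrib]
  refine Finset.sum_congr rfl fun i _ => Finset.sum_congr rfl fun k _ => ?_
  split_ifs with h
  · rw [Real.sign_of_neg (by linarith [hx h])]; ring
  · simp

section Interlacing

variable {n : ℕ} {I J : Finset (Fin n)} {k : Fin n}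

lemma elt_mem (l : ℕ) (h : l < I.card) : elt I l h ∈ I := Finset.orderEmbOfFin_mem _ _ _

lemma card_insert_of_forall_lt (hI : ∀ i ∈ I, i < k) : (insert k I).card = I.card + 1 :=
  Finset.card_insert_of_notMem fun h => lt_irrefl _ (hI k h)

lemma elt_insert (hI : ∀ i ∈ I, i < k) (l : ℕ) (h : l < (insert k I).card) :
    elt (insert k I) l h = if h' : l < I.card then elt I l h' else k := by
  have hc := card_insert_of_forall_lt hI
  let f : Fin (insert k I).card → Fin n :=
    fun l => if h' : (l : ℕ) < I.card then elt I l h' else k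
  have hf : f = (insert k I).orderEmbOfFin rfl := by
    refine Finset.orderEmbOfFin_unique rfl (fun l => ?_) fun a b hab => ?_
    · by_cases h' : (l : ℕ) < I.card
      · simp [f, h', elt_mem]
      · simp [f, h']
    · have hab' : (a : ℕ) < b := hab
      have ha : (a : ℕ) < I.card := by have := b.2; omega
      by_cases hb : (b : ℕ) < I.card
      · simp only [f, ha, hb, dif_pos, elt]
        exact (I.orderEmbOfFin rfl).strictMono (by simpa using hab')
      · simp only [f, ha, hb, dif_pos, dif_neg, not_false_eq_true]
        exact hI _ (elt_mem _ _)
  exact (congrFun hf ⟨l, h⟩).symm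

lemma interlaces_insert_right (hI : ∀ i ∈ I, i < k) (hJ : ∀ i ∈ J, i < k)
    (hc : I.card = J.card + 1) : Interlaces I (insert k J) ↔ Interlaces I J := by
  have hk := card_insert_of_forall_lt hJ
  constructor
  · rintro ⟨h1, h2⟩
    refine ⟨fun l hl hl' => ?_, fun l hl hl' => ?_⟩
    · have := h1 l hl (by omega)
      rwa [elt_insert hJ, dif_pos hl'] at this
    · have := h2 l (by omega) hl'
      rwa [elt_insert hJ, dif_pos hl] at this
  · rintro ⟨h1, h2⟩
    refine ⟨fun l hl hl' => ?_, fun l hl hl' => ?_⟩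
    · rw [elt_insert hJ]
      split_ifs with h
      · exact h1 l hl h
      · exact hI _ (elt_mem _ _)
    · rw [elt_insert hJ, dif_pos (by omega)]
      exact h2 l (by omega) hl'

lemma interlaces_insert_left (hI : ∀ i ∈ I, i < k) (hJ : ∀ i ∈ J, i < k)
    (hc : I.card = J.card) : Interlaces (insert k I) J ↔ Interlaces I J := by
  have hk := card_insert_of_forall_lt hI
  constructor
  · rintro ⟨h1, h2⟩
    refine ⟨fun l hl hl' => ?_, fun l hl hl' => ?_⟩
    · have := h1 l (by omega) hl'
      rwa [elt_insert hI, dif_pos hl] at this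
    · have := h2 l hl (by omega)
      rwa [elt_insert hI, dif_pos hl'] at this
  · rintro ⟨h1, h2⟩
    refine ⟨fun l hl hl' => ?_, fun l hl hl' => ?_⟩
    · rw [elt_insert hI, dif_pos (by omega)]
      exact h1 l (by omega) hl'
    · rw [elt_insert hI]
      split_ifs with h
      · exact h2 l hl h
      · exact hJ _ (elt_mem _ _)

lemma not_interlaces_insert_left (hI : ∀ i ∈ I, i < k) (hJ : ∀ i ∈ J, i ≤ k)
    (hc : (insert k I).card = J.card) : ¬ Interlaces (insert k I) J := by
  rintro ⟨h1, -⟩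
  have hk := card_insert_of_forall_lt hI
  have := h1 I.card (by omega) (by omega)
  rw [elt_insert hI, dif_neg (lt_irrefl _)] at this
  exact absurd this (not_lt.2 (hJ _ (elt_mem _ _)))

lemma not_interlaces_insert_right (hI : ∀ i ∈ I, i ≤ k) (hJ : ∀ i ∈ J, i < k)
    (hc : I.card = (insert k J).card + 1) : ¬ Interlaces I (insert k J) := by
  rintro ⟨-, h2⟩
  have hk := card_insert_of_forall_lt hJ
  have := h2 J.card (by omega) (by omega)
  rw [elt_insert hJ, dif_neg (lt_irrefl _)] at this
  exact absurd this (not_lt.2 (hI _ (elt_mem _ _)))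

end Interlacing

section GeneratingFunctions

variable {n : ℕ}

/-- The generating function in `z` of the sums over interlacing pairs of subsets `I < J` of `s`
with `|I| = |J| + d`, each pair weighted by `z ^ |J|`. -/
noncomputable def interlaceSum (d : ℕ) (m : Fin n → ℝ) (z : ℝ) (s : Finset (Fin n))
    (x : Fin n → ℝ) : ℝ :=
  ∑ I ∈ s.powerset, ∑ J ∈ s.powerset,
    if I.card = J.card + d ∧ Interlaces I J then
      z ^ J.card * ((∏ i ∈ I, m i * Real.exp (x i)) * ∏ k ∈ J, m k * Real.exp (-x k))
    else 0

lemma interlaceSum_zero_empty (m : Fin n → ℝ) (z : ℝ) (x : Fin n → ℝ) :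
    interlaceSum 0 m z ∅ x = 1 := by
  simp [interlaceSum, Interlaces]

lemma interlaceSum_one_empty (m : Fin n → ℝ) (z : ℝ) (x : Fin n → ℝ) :
    interlaceSum 1 m z ∅ x = 0 := by
  simp [interlaceSum]

lemma interlaceSum_zero_insert (m : Fin n → ℝ) (z : ℝ) {s : Finset (Fin n)} {k : Fin n}
    (hs : ∀ i ∈ s, i < k) (x : Fin n → ℝ) :
    interlaceSum 0 m z (insert k s) x =
      interlaceSum 0 m z s x + z * (m k * Real.exp (-x k)) * interlaceSum 1 m z s x := by
  have hks : k ∉ s := fun h => lt_irrefl _ (hs k h)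
  simp only [interlaceSum]
  rw [Finset.sum_powerset_insert hks]
  simp only [Finset.sum_powerset_insert hks, Finset.sum_add_distrib]
  rw [add_assoc]
  congr 1
  rw [Finset.mul_sum]
  simp only [Finset.mul_sum]
  have h0 : ∀ I ∈ s.powerset, ∀ J : Finset (Fin n), (∀ i ∈ J, i ≤ k) →
      ¬ ((insert k I).card = J.card + 0 ∧ Interlaces (insert k I) J) := by
    rintro I hI J hJ ⟨h1, h2⟩
    exact not_interlaces_insert_left (fun i hi => hs i (Finset.mem_powerset.1 hI hi)) hJ h1 h2
  have hz : ∀ t : Finset (Fin n) → Finset (Fin n), ∀ F : Finset (Fin n) → Finset (Fin n) → ℝ,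
      (∀ J ∈ s.powerset, ∀ i ∈ t J, i ≤ k) →
      (∑ I ∈ s.powerset, ∑ J ∈ s.powerset,
        if (insert k I).card = (t J).card + 0 ∧ Interlaces (insert k I) (t J)
          then F I J else 0) = 0 := fun t F ht =>
    Finset.sum_eq_zero fun I hI => Finset.sum_eq_zero fun J hJ =>
      if_neg (h0 I hI _ (ht J hJ))
  rw [hz (fun J => J) _ fun J hJ i hi => (hs i (Finset.mem_powerset.1 hJ hi)).le,
    hz (fun J => insert k J) _ fun J hJ i hi => ?_, add_zero, add_zero]
  · refine Finset.sum_congr rfl fun I hI => Finset.sum_congr rfl fun J hJ => ?_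
    have hI' : ∀ i ∈ I, i < k := fun i hi => hs i (Finset.mem_powerset.1 hI hi)
    have hJ' : ∀ i ∈ J, i < k := fun i hi => hs i (Finset.mem_powerset.1 hJ hi)
    have hkJ : k ∉ J := fun h => lt_irrefl _ (hJ' k h)
    rw [card_insert_of_forall_lt hJ', add_zero, Finset.prod_insert hkJ]
    by_cases hc : I.card = J.card + 1
    · simp only [interlaces_insert_right hI' hJ' hc, mul_ite, mul_zero]
      congr 1
      ring
    · simp [hc]
  · rcases Finset.mem_insert.1 hi with rfl | hi
    · exact le_rfl
    · exact (hs i (Finset.mem_powerset.1 hJ hi)).le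

lemma interlaceSum_one_insert (m : Fin n → ℝ) (z : ℝ) {s : Finset (Fin n)} {k : Fin n}
    (hs : ∀ i ∈ s, i < k) (x : Fin n → ℝ) :
    interlaceSum 1 m z (insert k s) x =
      interlaceSum 1 m z s x + m k * Real.exp (x k) * interlaceSum 0 m z s x := by
  have hks : k ∉ s := fun h => lt_irrefl _ (hs k h)
  simp only [interlaceSum]
  rw [Finset.sum_powerset_insert hks]
  simp only [Finset.sum_powerset_insert hks, Finset.sum_add_distrib]
  have hz : ∀ t : Finset (Fin n) → Finset (Fin n), ∀ F : Finset (Fin n) → Finset (Fin n) → ℝ,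
      (∀ I ∈ s.powerset, ∀ i ∈ t I, i ≤ k) →
      (∑ I ∈ s.powerset, ∑ J ∈ s.powerset,
        if (t I).card = (insert k J).card + 1 ∧ Interlaces (t I) (insert k J)
          then F I J else 0) = 0 := fun t F ht =>
    Finset.sum_eq_zero fun I hI => Finset.sum_eq_zero fun J hJ => if_neg fun h =>
      not_interlaces_insert_right (ht I hI)
        (fun i hi => hs i (Finset.mem_powerset.1 hJ hi)) h.1 h.2
  rw [hz (fun I => I) _ fun I hI i hi => (hs i (Finset.mem_powerset.1 hI hi)).le,
    hz (fun I => insert k I) _ fun I hI i hi => ?_, add_zero, add_zero]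
  · congr 1
    rw [Finset.mul_sum]
    simp only [Finset.mul_sum]
    refine Finset.sum_congr rfl fun I hI => Finset.sum_congr rfl fun J hJ => ?_
    have hI' : ∀ i ∈ I, i < k := fun i hi => hs i (Finset.mem_powerset.1 hI hi)
    have hJ' : ∀ i ∈ J, i < k := fun i hi => hs i (Finset.mem_powerset.1 hJ hi)
    have hkI : k ∉ I := fun h => lt_irrefl _ (hI' k h)
    rw [card_insert_of_forall_lt hI', add_zero, Finset.prod_insert hkI]
    by_cases hc : I.card = J.card
    · simp only [interlaces_insert_left hI' hJ' hc, mul_ite, mul_zero, hc]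
      congr 1
      · ring
    · simp [hc]
  · rcases Finset.mem_insert.1 hi with rfl | hi
    · exact le_rfl
    · exact (hs i (Finset.mem_powerset.1 hI hi)).le

/-- The Poisson relations between the generating functions at spectral parameters `z ≠ w`. -/
lemma exists_hasFDerivAt_interlaceSum (m : Fin n → ℝ) (x : Fin n → ℝ) (s : Finset (Fin n)) :
    ∃ da db : ℝ → (Fin n → ℝ) →L[ℝ] ℝ,
      (∀ z, HasFDerivAt (interlaceSum 0 m z s) (da z) x) ∧
      (∀ z, HasFDerivAt (interlaceSum 1 m z s) (db z) x) ∧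
      (∀ l, (∀ i ∈ s, i < l) → ∀ z, skewForm n (da z) (coordL l) = 0 ∧
        skewForm n (db z) (coordL l) = interlaceSum 1 m z s x) ∧
      ∀ z w, z ≠ w → skewForm n (da z) (da w) = 0 ∧ skewForm n (db z) (db w) = 0 ∧
        (z - w) * skewForm n (da z) (db w) =
          z * (interlaceSum 0 m z s x * interlaceSum 1 m w s x -
            interlaceSum 1 m z s x * interlaceSum 0 m w s x) := by
  induction s using Finset.induction_on_max with
  | empty =>
    refine ⟨fun _ => 0, fun _ => 0, fun z => ?_, fun z => ?_, ?_, ?_⟩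
    · rw [funext (interlaceSum_zero_empty m z)]; exact hasFDerivAt_const _ _
    · rw [funext (interlaceSum_one_empty m z)]; exact hasFDerivAt_const _ _
    · simp [interlaceSum_one_empty]
    · simp [interlaceSum_one_empty]
  | insert k s hs ih =>
    obtain ⟨da, db, ha, hb, hl, hzw⟩ := ih
    have hx : HasFDerivAt (fun y : Fin n → ℝ => y k) (coordL k) x :=
      (coordL k : (Fin n → ℝ) →L[ℝ] ℝ).hasFDerivAt
    set u := m k * Real.exp (x k) with hu
    set v := m k * Real.exp (-x k) with hv
    have hdu : HasFDerivAt (fun y : Fin n → ℝ => m k * Real.exp (y k)) (u • coordL k) x := by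
      refine (hx.exp.const_mul (m k)).congr_fderiv ?_
      rw [smul_smul]
    have hdv : HasFDerivAt (fun y : Fin n → ℝ => m k * Real.exp (-y k)) (-v • coordL k) x := by
      refine (hx.neg.exp.const_mul (m k)).congr_fderiv ?_
      rw [smul_smul, smul_neg]
      exact (neg_smul v (coordL k)).symm
    refine ⟨fun z => da z + (z * v) • db z - (z * v * interlaceSum 1 m z s x) • coordL k,
      fun z => db z + u • da z + (u * interlaceSum 0 m z s x) • coordL k,
      fun z => ?_, fun z => ?_, fun l hkl z => ?_, fun z w hne => ?_⟩
    · rw [funext (interlaceSum_zero_insert m z hs)]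
      refine ((ha z).add ((hdv.const_mul z).mul (hb z))).congr_fderiv ?_
      module
    · rw [funext (interlaceSum_one_insert m z hs)]
      refine ((hb z).add (hdu.mul (ha z))).congr_fderiv ?_
      module
    · have h1 := hl l (fun i hi => hkl i (Finset.mem_insert_of_mem hi)) z
      have h2 := skewForm_coordL (hkl k (Finset.mem_insert_self _ _))
      rw [interlaceSum_one_insert m z hs]
      simp only [map_add, map_sub, map_smul, LinearMap.add_apply, LinearMap.sub_apply,
        LinearMap.smul_apply, smul_eq_mul, h1.1, h1.2, h2]
      constructor <;> ring
    · obtain ⟨hX, hZ, hY⟩ := hzw z w hne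
      obtain ⟨-, -, hY'⟩ := hzw w z hne.symm
      have hz := hl k hs z
      have hw := hl k hs w
      have hsub : z - w ≠ 0 := sub_ne_zero.2 hne
      have hYe := eq_div_of_mul_eq hsub ((mul_comm _ _).trans hY)
      have hYe' := eq_div_of_mul_eq (sub_ne_zero.2 hne.symm) ((mul_comm _ _).trans hY')
      rw [← neg_sub z w, div_neg] at hYe'
      have e1 := skewForm_swap (coordL k) (da w)
      have e2 := skewForm_swap (coordL k) (db w)
      have e3 := skewForm_swap (db z) (da w)
      rw [hw.1] at e1
      rw [hw.2] at e2
      rw [hYe'] at e3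
      rw [interlaceSum_one_insert m z hs, interlaceSum_one_insert m w hs,
        interlaceSum_zero_insert m z hs, interlaceSum_zero_insert m w hs, ← hu, ← hv]
      simp only [map_add, map_sub, map_smul, LinearMap.add_apply, LinearMap.sub_apply,
        LinearMap.smul_apply, smul_eq_mul, hz.1, hz.2, e1, e2, e3, hX, hZ, hYe, skewForm_self]
      refine ⟨?_, ?_, ?_⟩ <;> field_simp <;> ring

lemma differentiable_Hfun (j : ℕ) (m : Fin n → ℝ) : Differentiable ℝ (Hfun n j m) := by
  unfold Hfun
  refine Differentiable.fun_sum fun I _ => Differentiable.fun_sum fun J _ => ?_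
  split_ifs
  · fun_prop
  · fun_prop

lemma interlaceSum_univ (m : Fin n → ℝ) (z : ℝ) (x : Fin n → ℝ) :
    interlaceSum 0 m z Finset.univ x = ∑ j ∈ Finset.range (n + 1), z ^ j * Hfun n j m x := by
  symm
  simp only [interlaceSum, Hfun, Finset.mul_sum, Finset.powerset_univ]
  rw [Finset.sum_comm]
  refine Finset.sum_congr rfl fun I _ => ?_
  rw [Finset.sum_comm]
  refine Finset.sum_congr rfl fun J _ => ?_
  have hJ : J.card < n + 1 := by simpa [Nat.lt_succ_iff] using Finset.card_le_univ J
  rw [Finset.sum_eq_single_of_mem J.card (Finset.mem_range.2 hJ)]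
  · simp
  · intro j _ hj
    simp [hj.symm]

end GeneratingFunctions

lemma coeff_eq_zero_of_sum_eq_zero {N : ℕ} {c : ℕ → ℝ} {w : ℝ}
    (h : ∀ z, z ≠ w → ∑ i ∈ Finset.range N, z ^ i * c i = 0) {i : ℕ} (hi : i < N) : c i = 0 := by
  let p : Polynomial ℝ := ∑ i ∈ Finset.range N, Polynomial.monomial i (c i)
  have hp : p = 0 := by
    refine Polynomial.eq_zero_of_infinite_isRoot p ?_
    refine (Set.Ioi_infinite w).mono fun z hz => ?_
    have := h z (ne_of_gt hz)
    simpa [p, Polynomial.eval_finsetSum, mul_comm] using this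
  have := congrArg (fun q => Polynomial.coeff q i) hp
  simpa [p, Polynomial.finsetSum_coeff, Polynomial.coeff_monomial, hi] using this

lemma skewForm_fderiv_Hfun {n : ℕ} (m x : Fin n → ℝ) {i j : ℕ} (hi : i ≤ n) (hj : j ≤ n) :
    skewForm n (fderiv ℝ (Hfun n i m) x) (fderiv ℝ (Hfun n j m) x) = 0 := by
  obtain ⟨da, db, ha, -, -, h⟩ := exists_hasFDerivAt_interlaceSum m x Finset.univ
  have hda : ∀ z, da z = ∑ j ∈ Finset.range (n + 1), z ^ j • fderiv ℝ (Hfun n j m) x := by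
    intro z
    refine (ha z).unique ?_
    rw [funext (interlaceSum_univ m z)]
    exact HasFDerivAt.fun_sum fun j _ => (differentiable_Hfun j m x).hasFDerivAt.const_mul _
  refine coeff_eq_zero_of_sum_eq_zero (N := n + 1) (w := 0)
    (c := fun i => skewForm n (fderiv ℝ (Hfun n i m) x) (fderiv ℝ (Hfun n j m) x))
    (fun z _ => ?_) (Nat.lt_succ_of_le hi)
  refine coeff_eq_zero_of_sum_eq_zero (N := n + 1) (w := z)
    (c := fun j => ∑ i ∈ Finset.range (n + 1),
      z ^ i * skewForm n (fderiv ℝ (Hfun n i m) x) (fderiv ℝ (Hfun n j m) x))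
    (fun w hw => ?_) (Nat.lt_succ_of_le hj)
  have := (h z w hw.symm).1
  rw [hda, hda] at this
  simpa only [map_sum, map_smul, LinearMap.sum_apply, LinearMap.smul_apply, smul_eq_mul]
    using this

theorem statement5 (K : ℕ) (hK : 1 ≤ K) (m : Fin (2 * K) → ℝ) (hm : ∀ i, 0 < m i)
    (i j : ℕ) (hi : 1 ≤ i) (hi' : i ≤ K) (hj : 1 ≤ j) (hj' : j ≤ K)
    (x : Fin (2 * K) → ℝ) (hx : StrictMono x) :
    pb (Hfun (2 * K) i m) (Hfun (2 * K) j m) x = 0 := by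
  rw [pb_eq_neg_skewForm _ _ hx, skewForm_fderiv_Hfun m x (by omega) (by omega), neg_zero]
end

section
/- Let K ≥ 1 and n = 2K+1, let m_1,…,m_n be positive real numbers. For 1 ≤ j ≤ K define H_j on ℝ^n by H_j(x) = Σ_{I<J} (Π_{i∈I} m_i e^{x_i}) (Π_{k∈J} m_k e^{−x_k}), the sum running over pairs of j-element subsets I, J of {1,…,n} with I < J (interlacing), and define H_c(x) = Π_{q=1}^{2K+1} m_q e^{(−1)^{q+1} x_q}. Then for every 1 ≤ j ≤ K, the Poisson bracket {H_j, H_c}(x) = 0 at every point x with x_1 < x_2 < ⋯ < x_n. -/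
open scoped Classical
open Finset

/-- Partial sums of the alternating sequence `(-1)^k` with the sign reversed after index `i` and
the `i`-th term removed. -/
lemma sum_range_signed_alternating (i N : ℕ) :
    ∑ k ∈ Finset.range N, ((if k < i then (-1 : ℝ) ^ k else 0) - if i < k then (-1) ^ k else 0) =
      if i < N then (1 + (-1) ^ N) / 2 else (1 - (-1) ^ N) / 2 := by
  induction N with
  | zero => simp
  | succ N ih =>
    rw [Finset.sum_range_succ, ih, pow_succ]
    rcases lt_trichotomy i N with h | rfl | h
    · rw [if_pos h, if_neg (by omega), if_pos h, if_pos (by omega)]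
      ring
    · simp [sub_eq_add_neg]
    · rw [if_neg (by omega), if_pos h, if_neg (by omega), if_neg (by omega)]
      ring

/-- The alternating covector lies in the kernel of the constant antisymmetric form
`∑_{i<k} (a_i b_k - a_k b_i)` in odd dimension. -/
lemma sum_lt_alternating_eq_zero (K : ℕ) (a : Fin (2 * K + 1) → ℝ) :
    ∑ i : Fin (2 * K + 1), ∑ k : Fin (2 * K + 1),
      (if i < k then a k * (-1) ^ (i : ℕ) - a i * (-1) ^ (k : ℕ) else 0) = 0 := by
  have split : ∀ i k : Fin (2 * K + 1),
      (if i < k then a k * (-1) ^ (i : ℕ) - a i * (-1) ^ (k : ℕ) else 0) =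
        (if i < k then a k * (-1) ^ (i : ℕ) else 0) -
          if i < k then a i * (-1) ^ (k : ℕ) else 0 := by
    intro i k
    split_ifs <;> ring
  simp_rw [split, Finset.sum_sub_distrib]
  rw [Finset.sum_comm, ← Finset.sum_sub_distrib]
  refine Finset.sum_eq_zero fun i _ => ?_
  have h := sum_range_signed_alternating i (2 * K + 1)
  rw [if_pos i.isLt, Odd.neg_one_pow ⟨K, rfl⟩, ← Fin.sum_univ_eq_sum_range
    (fun k => (if k < (i : ℕ) then (-1 : ℝ) ^ k else 0) - if (i : ℕ) < k then (-1) ^ k else 0)] at h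
  rw [← Finset.sum_sub_distrib]
  calc _ = a i * ∑ k : Fin (2 * K + 1), ((if (k : ℕ) < i then (-1 : ℝ) ^ (k : ℕ) else 0) -
        if (i : ℕ) < k then (-1) ^ (k : ℕ) else 0) := by
        rw [Finset.mul_sum]
        refine Finset.sum_congr rfl fun k _ => ?_
        simp only [Fin.lt_def, mul_sub, mul_ite, mul_zero]
    _ = 0 := by rw [h]; norm_num

/-- Partial derivatives of a product of exponentials of multiples of the coordinates. -/
lemma fderiv_prod_mul_exp_apply_single {n : ℕ} (m s x : Fin n → ℝ) (i : Fin n) :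
    fderiv ℝ (fun y : Fin n → ℝ => ∏ q, m q * Real.exp (s q * y q)) x (Pi.single i 1) =
      (∏ q, m q * Real.exp (s q * x q)) * s i := by
  have hfun : (fun y : Fin n → ℝ => ∏ q, m q * Real.exp (s q * y q)) =
      fun y => (∏ q, m q) * Real.exp (∑ q, s q * y q) := by
    funext y
    rw [Finset.prod_mul_distrib, Real.exp_sum]
  have hsum : HasFDerivAt (fun y : Fin n → ℝ => ∑ q, s q * y q)
      (∑ q, s q • ContinuousLinearMap.proj (R := ℝ) (φ := fun _ : Fin n => ℝ) q) x :=
    HasFDerivAt.fun_sum fun q _ => (hasFDerivAt_apply q x).const_mul (s q)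
  rw [hfun, (hsum.exp.const_mul (∏ q, m q)).fderiv, Finset.prod_mul_distrib, Real.exp_sum]
  simp [Pi.single_apply, mul_assoc]

/-- On the ordered chamber, the alternating product of exponentials Poisson commutes with every
function. -/
lemma pb_alternating_prod_exp_eq_zero (K : ℕ) (m : Fin (2 * K + 1) → ℝ)
    (f : (Fin (2 * K + 1) → ℝ) → ℝ) (x : Fin (2 * K + 1) → ℝ) (hx : StrictMono x) :
    pb f (fun y => ∏ q : Fin (2 * K + 1), m q * Real.exp ((-1 : ℝ) ^ (q : ℕ) * y q)) x = 0 := by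
  unfold pb
  simp_rw [fderiv_prod_mul_exp_apply_single m (fun q => (-1 : ℝ) ^ (q : ℕ)) x]
  set c := ∏ q : Fin (2 * K + 1), m q * Real.exp ((-1 : ℝ) ^ (q : ℕ) * x q)
  refine Eq.trans ?_
    (sum_lt_alternating_eq_zero K fun i => c * fderiv ℝ f x (Pi.single i 1))
  refine Finset.sum_congr rfl fun i _ => Finset.sum_congr rfl fun k _ => ?_
  split_ifs with h
  · rw [Real.sign_of_neg (sub_neg.mpr (hx h))]
    ring
  · rfl

/-- Indices are 0-based: the paper's `(-1)^{q+1} x_q` for `1 ≤ q ≤ 2K+1`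
corresponds to `(-1)^q x_q` for `q : Fin (2K+1)`. -/
theorem statement7 (K : ℕ) (hK : 1 ≤ K) (m : Fin (2 * K + 1) → ℝ) (hm : ∀ i, 0 < m i)
    (j : ℕ) (hj : 1 ≤ j) (hj' : j ≤ K)
    (x : Fin (2 * K + 1) → ℝ) (hx : StrictMono x) :
    pb (Hfun (2 * K + 1) j m)
      (fun y => ∏ q : Fin (2 * K + 1), m q * Real.exp ((-1 : ℝ) ^ (q : ℕ) * y q)) x = 0 := by
  exact pb_alternating_prod_exp_eq_zero K m _ x hx
end

section
/- Let n ≥ 1 and let x_1,…,x_n be pairwise distinct real numbers. Let A be the n×n real matrix with entries A_{ik} = sgn(x_i − x_k). Then the rank of A equals 2⌊n/2⌋; that is, rank(A) = n if n is even and rank(A) = n−1 if n is odd. -/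
/-- The integer matrix of signs of the differences of the entries of `x`. -/
noncomputable def intSignMatrix {ι : Type*} (x : ι → ℝ) : Matrix ι ι ℤ :=
  Matrix.of fun i k => if x k < x i then 1 else if x i < x k then -1 else 0

theorem intSignMatrix_map_intCast {ι : Type*} (x : ι → ℝ) :
    (intSignMatrix x).map (Int.castRingHom ℝ) =
      Matrix.of fun i k => Real.sign (x i - x k) := by
  ext i k
  rcases lt_trichotomy (x k) (x i) with h | h | h
  · simp [intSignMatrix, h, Real.sign_of_pos]
  · simp [intSignMatrix, h]
  · simp [intSignMatrix, h, h.not_gt, Real.sign_of_neg]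

/-- Over `ZMod 2` and in even size, the matrix with zero diagonal and all other entries equal to
one is its own inverse. -/
theorem allOnes_add_one_mul_self {ι : Type*} [Fintype ι] [DecidableEq ι]
    (hι : Even (Fintype.card ι)) :
    ((Matrix.of fun _ _ => 1 : Matrix ι ι (ZMod 2)) + 1) * (Matrix.of (fun _ _ => 1) + 1) = 1 := by
  have hJ : (Matrix.of fun _ _ => 1 : Matrix ι ι (ZMod 2)) * Matrix.of (fun _ _ => 1) = 0 := by
    ext i k
    simpa [Matrix.mul_apply] using (ZMod.natCast_eq_zero_iff_even).2 hι
  have hJJ : (Matrix.of fun _ _ => 1 : Matrix ι ι (ZMod 2)) + Matrix.of (fun _ _ => 1) = 0 := by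
    ext i k
    exact CharTwo.add_self_eq_zero _
  rw [add_mul, mul_add, hJ, mul_one, one_mul, zero_add, ← add_assoc, hJJ, zero_add]

theorem intSignMatrix_map_zmod {ι : Type*} [DecidableEq ι] {x : ι → ℝ}
    (hx : Function.Injective x) :
    (intSignMatrix x).map (Int.castRingHom (ZMod 2)) = Matrix.of (fun _ _ => 1) + 1 := by
  ext i k
  rcases eq_or_ne i k with rfl | h
  · simp [intSignMatrix, CharTwo.add_self_eq_zero]
  · rcases (hx.ne h).lt_or_gt with h' | h' <;>
      simp [intSignMatrix, h, h', h'.not_gt]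

theorem det_sign_sub_ne_zero {ι : Type*} [Fintype ι] [DecidableEq ι]
    (hι : Even (Fintype.card ι)) {x : ι → ℝ} (hx : Function.Injective x) :
    (Matrix.of fun i k => Real.sign (x i - x k)).det ≠ 0 := by
  rw [← intSignMatrix_map_intCast, ← RingHom.mapMatrix_apply, ← RingHom.map_det]
  intro h
  have h0 : (intSignMatrix x).det = 0 := by simpa using h
  have h1 := congrArg Matrix.det (allOnes_add_one_mul_self hι)
  rw [← intSignMatrix_map_zmod hx, Matrix.det_mul, ← RingHom.mapMatrix_apply,
    ← RingHom.map_det, h0] at h1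
  simp at h1

theorem det_sign_sub_eq_zero {ι : Type*} [Fintype ι] [DecidableEq ι]
    (hι : Odd (Fintype.card ι)) (x : ι → ℝ) :
    (Matrix.of fun i k => Real.sign (x i - x k)).det = 0 := by
  set A : Matrix ι ι ℝ := Matrix.of fun i k => Real.sign (x i - x k) with hA
  have hT : A.transpose = -A := by
    ext i k
    simp [hA, ← Real.sign_neg]
  have h := A.det_transpose
  rw [hT, Matrix.det_neg, hι.neg_one_pow] at h
  linarith

theorem rank_sign_sub_of_even {ι : Type*} [Fintype ι]
    (hι : Even (Fintype.card ι)) {x : ι → ℝ} (hx : Function.Injective x) :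
    (Matrix.of fun i k => Real.sign (x i - x k)).rank = Fintype.card ι := by
  classical
  exact Matrix.rank_of_isUnit _
    ((Matrix.isUnit_iff_isUnit_det _).2 (det_sign_sub_ne_zero hι hx).isUnit)

/-- A singular square matrix over a field does not have full rank. -/
theorem Matrix.rank_lt_card_of_det_eq_zero {ι K : Type*} [Fintype ι] [DecidableEq ι] [Field K]
    {A : Matrix ι ι K} (hA : A.det = 0) : A.rank < Fintype.card ι := by
  obtain ⟨v, hv, hAv⟩ := Matrix.exists_mulVec_eq_zero_iff.2 hA
  have hker : 0 < Module.finrank K (LinearMap.ker A.mulVecLin) :=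
    Module.finrank_pos_iff_exists_ne_zero.2 ⟨⟨v, by simpa using hAv⟩, by simpa using hv⟩
  have h := A.mulVecLin.finrank_range_add_finrank_ker
  rw [Module.finrank_fintype_fun_eq_card] at h
  rw [Matrix.rank]
  omega

theorem statement8 (n : ℕ) (hn : 1 ≤ n) (x : Fin n → ℝ)
    (hx : Function.Injective x) :
    (Matrix.of fun i k : Fin n => Real.sign (x i - x k)).rank = 2 * (n / 2) := by
  rcases Nat.even_or_odd n with h | h
  · rw [rank_sign_sub_of_even (by simpa using h) hx, Fintype.card_fin,
      Nat.two_mul_div_two_of_even h]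
  · obtain ⟨m, rfl⟩ : ∃ m, n = m + 1 := ⟨n - 1, by omega⟩
    have hm : Even m := by grind
    have hlt := Matrix.rank_lt_card_of_det_eq_zero (det_sign_sub_eq_zero (by simpa using h) x)
    have hge := Matrix.rank_submatrix_le
      (Matrix.of fun i k : Fin (m + 1) => Real.sign (x i - x k)) Fin.castSucc Fin.castSucc
    have hsub := rank_sign_sub_of_even (by simpa using hm)
      (hx.comp (Fin.castSucc_injective m))
    rw [Fintype.card_fin] at hlt hsub
    have hge' : m ≤ _ := hsub.symm.le.trans hge
    grind
end

section
/- Let K ≥ 1 and n = 2K. Define functions p_k and q_k on ℝ^n by p_k(x) = x_{2k} − x_{2k−1} and q_k(x) = Σ_{j=1}^{k} (x_{2j−1} − x_{2j−2}) for 1 ≤ k ≤ K, with the convention x_0 = 0. Then at every point x with x_1 < x_2 < ⋯ < x_n, the Poisson brackets satisfy {p_k, q_m}(x) = δ_{km}, {p_k, p_m}(x) = 0, and {q_k, q_m}(x) = 0 for all 1 ≤ k, m ≤ K, where δ_{km} is the Kronecker delta. -/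
open scoped Classical
open Finset

/-- `p_k(x) = x_{2k} - x_{2k-1}` in the paper's 1-based indexing; here
`k : Fin K` is 0-based, so `x_{2k-1}` is coordinate `2k` and `x_{2k}` is `2k+1`. -/
noncomputable def pfun (K : ℕ) (k : Fin K) (y : Fin (2 * K) → ℝ) : ℝ :=
  y ⟨2 * k.val + 1, by have := k.isLt; omega⟩ - y ⟨2 * k.val, by have := k.isLt; omega⟩

/-- `q_k(x) = ∑_{j=1}^k (x_{2j-1} - x_{2j-2})` with the convention `x_0 = 0`
(1-based indexing in the paper).  With 0-based `j : Fin K`, the term for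
`j ≤ k` is `x_{2j} - x_{2j-1}`, where the second summand is taken to be `0`
when `j = 0`. -/
noncomputable def qfun (K : ℕ) (k : Fin K) (y : Fin (2 * K) → ℝ) : ℝ :=
  ∑ j : Fin K,
    if j ≤ k then
      y ⟨2 * j.val, by have := j.isLt; omega⟩ -
        (if j.val = 0 then 0 else y ⟨2 * j.val - 1, by have := j.isLt; omega⟩)
    else 0

/-- A linear functional on `ℝ^n` is its own derivative at every point. -/
lemma fderiv_apply_of_isLinearMap {n : ℕ} {f : (Fin n → ℝ) → ℝ} (hf : IsLinearMap ℝ f)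
    (x v : Fin n → ℝ) : fderiv ℝ f x v = f v := by
  have h : HasFDerivAt f (LinearMap.toContinuousLinearMap (hf.mk' f)) x :=
    (LinearMap.toContinuousLinearMap (hf.mk' f)).hasFDerivAt
  rw [h.fderiv]
  rfl

lemma isLinearMap_pfun (K : ℕ) (k : Fin K) : IsLinearMap ℝ (pfun K k) where
  map_add y z := by simp only [pfun, Pi.add_apply]; ring
  map_smul c y := by simp only [pfun, Pi.smul_apply, smul_eq_mul]; ring

lemma isLinearMap_qfun (K : ℕ) (k : Fin K) : IsLinearMap ℝ (qfun K k) where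
  map_add y z := by
    simp only [qfun, Pi.add_apply, ← Finset.sum_add_distrib]
    refine Finset.sum_congr rfl fun j _ => ?_
    split_ifs <;> ring
  map_smul c y := by
    simp only [qfun, Pi.smul_apply, smul_eq_mul, Finset.mul_sum]
    refine Finset.sum_congr rfl fun j _ => ?_
    split_ifs <;> ring

lemma pfun_single (K : ℕ) (k : Fin K) (i : Fin (2 * K)) :
    pfun K k (Pi.single i 1) =
      (if i.val = 2 * k.val + 1 then 1 else 0) - (if i.val = 2 * k.val then 1 else 0) := by
  simp only [pfun, Pi.single_apply, Fin.ext_iff, eq_comm]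

lemma qfun_single (K : ℕ) (m : Fin K) (i : Fin (2 * K)) :
    qfun K m (Pi.single i 1) = if i.val ≤ 2 * m.val then (-1) ^ i.val else 0 := by
  have hi := i.isLt
  have hm := m.isLt
  simp only [qfun, Pi.single_apply, Fin.ext_iff, Fin.le_def]
  rcases Nat.even_or_odd' i.val with ⟨t, ht | ht⟩
  · rw [Finset.sum_eq_single (⟨t, by omega⟩ : Fin K)]
    · simp only [ht, pow_mul]
      split_ifs <;> first | omega | norm_num
    · intro j _ hj
      have hj' : j.val ≠ t := fun h => hj (Fin.ext h)
      split_ifs <;> first | omega | norm_num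
    · simp
  · by_cases htK : t + 1 < K
    · rw [Finset.sum_eq_single (⟨t + 1, htK⟩ : Fin K)]
      · simp only [ht, pow_succ, pow_mul]
        split_ifs <;> first | contradiction | omega | norm_num
      · intro j _ hj
        have hj' : j.val ≠ t + 1 := fun h => hj (Fin.ext h)
        split_ifs <;> first | omega | norm_num
      · simp
    · rw [if_neg (by omega)]
      refine Finset.sum_eq_zero fun j _ => ?_
      have hj := j.isLt
      split_ifs <;> first | omega | norm_num

/-- On the chamber `x_1 < ⋯ < x_n`, the bracket of the coordinates `x_i` and `x_j`. -/
def chamberSign (i j : ℕ) : ℝ := if j < i then 1 else if i < j then -1 else 0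

lemma pb_eq_sum {n : ℕ} {f g : (Fin n → ℝ) → ℝ} (hf : IsLinearMap ℝ f) (hg : IsLinearMap ℝ g)
    {x : Fin n → ℝ} (hx : StrictMono x) :
    pb f g x = ∑ i : Fin n, ∑ j : Fin n,
      f (Pi.single i 1) * (chamberSign i j * g (Pi.single j 1)) := by
  have split : ∀ i j : Fin n, f (Pi.single i 1) * (chamberSign i j * g (Pi.single j 1)) =
      (if i < j then -(f (Pi.single i 1) * g (Pi.single j 1)) else 0) +
        (if j < i then f (Pi.single i 1) * g (Pi.single j 1) else 0) := by
    intro i j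
    simp only [chamberSign, Fin.lt_def]
    split_ifs <;> first | omega | ring
  simp only [split, Finset.sum_add_distrib]
  rw [Finset.sum_comm (f := fun i j : Fin n =>
    if j < i then f (Pi.single i 1) * g (Pi.single j 1) else 0)]
  simp only [← Finset.sum_add_distrib, pb, fderiv_apply_of_isLinearMap hf,
    fderiv_apply_of_isLinearMap hg]
  refine Finset.sum_congr rfl fun i _ => Finset.sum_congr rfl fun j _ => ?_
  split_ifs with h
  · rw [Real.sign_of_neg (sub_neg.mpr (hx h))]
    ring
  · ring

lemma pb_antisymm {n : ℕ} (f g : (Fin n → ℝ) → ℝ) (x : Fin n → ℝ) : pb f g x = -pb g f x := by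
  simp only [pb, ← Finset.sum_neg_distrib]
  refine Finset.sum_congr rfl fun i _ => Finset.sum_congr rfl fun j _ => ?_
  split_ifs <;> ring

lemma pb_pfun {K : ℕ} (k : Fin K) {g : (Fin (2 * K) → ℝ) → ℝ} (hg : IsLinearMap ℝ g)
    {x : Fin (2 * K) → ℝ} (hx : StrictMono x) :
    pb (pfun K k) g x = g (Pi.single ⟨2 * k.val, by have := k.isLt; omega⟩ 1) +
      g (Pi.single ⟨2 * k.val + 1, by have := k.isLt; omega⟩ 1) := by
  have hk := k.isLt
  rw [pb_eq_sum (isLinearMap_pfun K k) hg hx, Finset.sum_comm]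
  have inner : ∀ j : Fin (2 * K),
      ∑ i : Fin (2 * K), pfun K k (Pi.single i 1) * (chamberSign i j * g (Pi.single j 1)) =
        (if j = ⟨2 * k.val, by omega⟩ then g (Pi.single j 1) else 0) +
        (if j = ⟨2 * k.val + 1, by omega⟩ then g (Pi.single j 1) else 0) := by
    intro j
    have h0 : ∀ i : Fin (2 * K), i.val = 2 * k.val ↔ i = ⟨2 * k.val, by omega⟩ :=
      fun i => by rw [Fin.ext_iff]
    have h1 : ∀ i : Fin (2 * K), i.val = 2 * k.val + 1 ↔ i = ⟨2 * k.val + 1, by omega⟩ :=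
      fun i => by rw [Fin.ext_iff]
    simp only [pfun_single, sub_mul, ite_mul, one_mul, zero_mul, Finset.sum_sub_distrib, h0, h1,
      Finset.sum_ite_eq', Finset.mem_univ, if_true]
    simp only [chamberSign, Fin.ext_iff]
    split_ifs <;> first | omega | ring
  simp only [inner, Finset.sum_add_distrib, Finset.sum_ite_eq', Finset.mem_univ, if_true]

/-- Partial sums of the bracket of a coordinate with the alternating sum of `x_0, …, x_{2m}`. -/
lemma sum_range_chamberSign_mul (m i : ℕ) (hi : i ≤ 2 * m) (N : ℕ) :
    ∑ j ∈ Finset.range N, chamberSign i j * (if j ≤ 2 * m then (-1) ^ j else 0) =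
      if N ≤ i then (if Even N then 0 else 1)
      else if N ≤ 2 * m + 1 then (if Even N then 1 else 0) else 0 := by
  induction N with
  | zero => simp
  | succ N ih =>
    rw [Finset.sum_range_succ, ih, chamberSign]
    rcases Nat.even_or_odd N with h | h
    · have h' : ¬ Even (N + 1) := by simpa [Nat.even_add_one] using h
      simp only [h, h', h.neg_one_pow, if_true, if_false]
      obtain ⟨t, rfl⟩ := h
      split_ifs <;> first | omega | norm_num
    · have h' : Even (N + 1) := h.add_one
      simp only [Nat.not_even_iff_odd.mpr h, h', h.neg_one_pow, if_true, if_false]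
      obtain ⟨t, rfl⟩ := h
      split_ifs <;> first | omega | norm_num

lemma pb_qfun_qfun_of_le {K : ℕ} {k m : Fin K} (hkm : k ≤ m) {x : Fin (2 * K) → ℝ}
    (hx : StrictMono x) : pb (qfun K k) (qfun K m) x = 0 := by
  rw [pb_eq_sum (isLinearMap_qfun K k) (isLinearMap_qfun K m) hx]
  refine Finset.sum_eq_zero fun i _ => ?_
  rw [← Finset.mul_sum, qfun_single]
  split_ifs with hi
  · have hm := m.isLt
    have hle : k.val ≤ m.val := hkm
    simp only [qfun_single]
    rw [Fin.sum_univ_eq_sum_range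
      (fun j => chamberSign i j * (if j ≤ 2 * m.val then (-1) ^ j else 0)) (2 * K),
      sum_range_chamberSign_mul m i (by omega), if_neg (by omega), if_neg (by omega), mul_zero]
  · rw [zero_mul]

theorem statement9 (K : ℕ) (hK : 1 ≤ K) (x : Fin (2 * K) → ℝ) (hx : StrictMono x)
    (k m : Fin K) :
    pb (pfun K k) (qfun K m) x = (if k = m then (1 : ℝ) else 0) ∧
    pb (pfun K k) (pfun K m) x = 0 ∧
    pb (qfun K k) (qfun K m) x = 0 := by
  refine ⟨?_, ?_, ?_⟩
  · rw [pb_pfun k (isLinearMap_qfun K m) hx, qfun_single, qfun_single]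
    simp only [pow_succ, pow_mul, Fin.ext_iff]
    split_ifs <;> first | omega | norm_num
  · rw [pb_pfun k (isLinearMap_pfun K m) hx, pfun_single, pfun_single]
    simp only
    split_ifs <;> first | omega | norm_num
  · rcases le_total k m with h | h
    · exact pb_qfun_qfun_of_le h hx
    · rw [pb_antisymm, pb_qfun_qfun_of_le h hx, neg_zero]
end

section
/- Let n ≥ 1, let m_1,…,m_n be real numbers, and let x_1,…,x_n be pairwise distinct real numbers. Define u : ℝ → ℝ by u(x) = Σ_{j=1}^n m_j e^{−|x−x_j|}, and define v : ℝ → ℝ by v(x) = Σ_{j=1}^n m_j sgn(x_j − x) e^{−|x−x_j|} (so v equals the derivative of u at every point x ∉ {x_1,…,x_n}). Then ∫_ℝ (u(x)² + v(x)²) dx = 2 Σ_{i,k=1}^n m_i m_k e^{−|x_i−x_k|}. In particular the squared H¹(ℝ) norm of u equals 2 Σ_{i,k=1}^n m_i m_k e^{−|x_i−x_k|}. -/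
open Finset MeasureTheory

theorem peakon_kernel_ae_eq {a b : ℝ} (hab : a ≤ b) :
    (fun t : ℝ ↦ Real.exp (-|t - a|) * Real.exp (-|t - b|) *
        (1 + Real.sign (a - t) * Real.sign (b - t))) =ᵐ[volume]
      fun t ↦ (Set.Iic a).indicator (fun t ↦ 2 * Real.exp (-(a + b)) * Real.exp (2 * t)) t +
        (Set.Ioi b).indicator (fun t ↦ 2 * Real.exp (a + b) * Real.exp (-2 * t)) t := by
  filter_upwards [Measure.ae_ne volume a, Measure.ae_ne volume b] with t hta htb
  rcases lt_or_gt_of_ne hta with h | h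
  · have hb : t < b := h.trans_le hab
    rw [Set.indicator_of_mem (Set.mem_Iic.2 h.le),
      Set.indicator_of_notMem (Set.notMem_Ioi.2 hb.le),
      Real.sign_of_pos (sub_pos.2 h), Real.sign_of_pos (sub_pos.2 hb),
      abs_of_neg (sub_neg.2 h), abs_of_neg (sub_neg.2 hb), mul_assoc 2, ← Real.exp_add,
      ← Real.exp_add]
    ring_nf
  · rw [Set.indicator_of_notMem (Set.notMem_Iic.2 h), Real.sign_of_neg (sub_neg.2 h)]
    rcases lt_or_gt_of_ne htb with hb | hb
    · rw [Set.indicator_of_notMem (Set.notMem_Ioi.2 hb.le), Real.sign_of_pos (sub_pos.2 hb)]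
      ring
    · rw [Set.indicator_of_mem (Set.mem_Ioi.2 hb), Real.sign_of_neg (sub_neg.2 hb),
        abs_of_pos (sub_pos.2 h), abs_of_pos (sub_pos.2 hb), mul_assoc 2, ← Real.exp_add,
        ← Real.exp_add]
      ring_nf

theorem integrable_and_integral_peakon_kernel_of_le {a b : ℝ} (hab : a ≤ b) :
    Integrable (fun t : ℝ ↦ Real.exp (-|t - a|) * Real.exp (-|t - b|) *
        (1 + Real.sign (a - t) * Real.sign (b - t))) ∧
      ∫ t : ℝ, Real.exp (-|t - a|) * Real.exp (-|t - b|) *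
        (1 + Real.sign (a - t) * Real.sign (b - t)) = 2 * Real.exp (-|a - b|) := by
  have hleft : Integrable ((Set.Iic a).indicator
      fun t ↦ 2 * Real.exp (-(a + b)) * Real.exp (2 * t)) :=
    (integrable_indicator_iff measurableSet_Iic).2
      ((integrableOn_exp_mul_Iic two_pos a).const_mul _)
  have hright : Integrable ((Set.Ioi b).indicator
      fun t ↦ 2 * Real.exp (a + b) * Real.exp (-2 * t)) :=
    (integrable_indicator_iff measurableSet_Ioi).2
      ((integrableOn_exp_mul_Ioi (by norm_num) b).const_mul _)
  refine ⟨(hleft.add hright).congr (peakon_kernel_ae_eq hab).symm, ?_⟩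
  rw [integral_congr_ae (peakon_kernel_ae_eq hab), integral_add hleft hright,
    integral_indicator measurableSet_Iic, integral_indicator measurableSet_Ioi,
    integral_const_mul, integral_const_mul, integral_exp_mul_Iic two_pos,
    integral_exp_mul_Ioi (by norm_num), abs_of_nonpos (sub_nonpos.2 hab)]
  have h₁ : Real.exp (-(a + b)) * Real.exp (2 * a) = Real.exp (a - b) := by
    rw [← Real.exp_add]; ring_nf
  have h₂ : Real.exp (a + b) * Real.exp (-2 * b) = Real.exp (a - b) := by
    rw [← Real.exp_add]; ring_nf
  rw [neg_neg]
  linear_combination h₁ + h₂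

theorem integrable_and_integral_peakon_kernel (a b : ℝ) :
    Integrable (fun t : ℝ ↦ Real.exp (-|t - a|) * Real.exp (-|t - b|) *
        (1 + Real.sign (a - t) * Real.sign (b - t))) ∧
      ∫ t : ℝ, Real.exp (-|t - a|) * Real.exp (-|t - b|) *
        (1 + Real.sign (a - t) * Real.sign (b - t)) = 2 * Real.exp (-|a - b|) := by
  rcases le_total a b with h | h
  · exact integrable_and_integral_peakon_kernel_of_le h
  · simpa only [mul_comm, abs_sub_comm] using integrable_and_integral_peakon_kernel_of_le h

theorem statement12 (n : ℕ) (hn : 1 ≤ n) (m : Fin n → ℝ) (x : Fin n → ℝ)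
    (hx : Function.Injective x) :
    ∫ t : ℝ,
        ((∑ j : Fin n, m j * Real.exp (-|t - x j|)) ^ 2 +
         (∑ j : Fin n, m j * Real.sign (x j - t) * Real.exp (-|t - x j|)) ^ 2) =
      2 * ∑ i : Fin n, ∑ k : Fin n, m i * m k * Real.exp (-|x i - x k|) := by
  have hint (i k : Fin n) : Integrable fun t : ℝ ↦ m i * m k *
      (Real.exp (-|t - x i|) * Real.exp (-|t - x k|) *
        (1 + Real.sign (x i - t) * Real.sign (x k - t))) :=
    (integrable_and_integral_peakon_kernel (x i) (x k)).1.const_mul _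
  calc
    _ = ∫ t : ℝ, ∑ i : Fin n, ∑ k : Fin n, m i * m k *
        (Real.exp (-|t - x i|) * Real.exp (-|t - x k|) *
          (1 + Real.sign (x i - t) * Real.sign (x k - t))) := by
      congr 1 with t
      simp only [sq, sum_mul_sum, ← sum_add_distrib]
      refine sum_congr rfl fun i _ ↦ sum_congr rfl fun k _ ↦ ?_
      ring
    _ = _ := by
      rw [integral_finsetSum _ fun i _ ↦ integrable_finsetSum _ fun k _ ↦ hint i k, mul_sum]
      refine sum_congr rfl fun i _ ↦ ?_
      rw [integral_finsetSum _ fun k _ ↦ hint i k, mul_sum]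
      refine sum_congr rfl fun k _ ↦ ?_
      rw [integral_const_mul, (integrable_and_integral_peakon_kernel (x i) (x k)).2]
      ring
end

section
/- Let K ≥ 1 and n = 2K, and let m_1,…,m_n be positive real numbers. For 1 ≤ j ≤ K define H_j on ℝ^n by H_j(x) = Σ_{I<J} (Π_{i∈I} m_i e^{x_i}) (Π_{k∈J} m_k e^{−x_k}), the sum running over pairs of j-element subsets I, J of {1,…,n} with I < J (interlacing). Then the set of points x in the open chamber M = {x ∈ ℝ^n : x_1 < x_2 < ⋯ < x_n} at which the K gradient vectors ∇H_1(x), …, ∇H_K(x) ∈ ℝ^n are linearly independent is dense in M. -/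
open scoped Classical
open Finset

/-- The gradient vector `∇H_j(x) ∈ ℝ^n` of `H_j`. -/
noncomputable def gradH (n j : ℕ) (m : Fin n → ℝ) (x : Fin n → ℝ) : Fin n → ℝ :=
  fun i => fderiv ℝ (Hfun n j m) x (Pi.single i 1)

/-- The exponent of `e^{x_k}` in the monomial `∏_{i∈I} e^{x_i} ∏_{k∈J} e^{-x_k}`. -/
noncomputable def expo {n : ℕ} (p : Finset (Fin n) × Finset (Fin n)) (k : Fin n) : ℝ :=
  (if k ∈ p.1 then 1 else 0) - (if k ∈ p.2 then 1 else 0)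

/-- The interlacing pairs of `j`-element subsets of `{1,…,n}`. -/
noncomputable def interlacingPairs (n j : ℕ) : Finset (Finset (Fin n) × Finset (Fin n)) :=
  univ.filter fun p => p.1.card = j ∧ p.2.card = j ∧ Interlaces p.1 p.2

/-- The mass factor of the monomial indexed by `p`. -/
noncomputable def massCoeff {n : ℕ} (m : Fin n → ℝ) (p : Finset (Fin n) × Finset (Fin n)) : ℝ :=
  (∏ i ∈ p.1, m i) * ∏ k ∈ p.2, m k

lemma Hfun_eq_sum_exp (n j : ℕ) (m : Fin n → ℝ) (x : Fin n → ℝ) :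
    Hfun n j m x =
      ∑ p ∈ interlacingPairs n j, massCoeff m p * Real.exp (∑ k, expo p k * x k) := by
  unfold Hfun interlacingPairs
  rw [Finset.sum_filter, ← Finset.univ_product_univ, Finset.sum_product]
  refine Finset.sum_congr rfl fun I _ => Finset.sum_congr rfl fun J _ => ?_
  refine if_congr Iff.rfl ?_ rfl
  have h : ∑ k, expo (I, J) k * x k = ∑ i ∈ I, x i + ∑ k ∈ J, -x k := by
    simp only [expo, sub_mul, Finset.sum_sub_distrib]
    simp [sub_eq_add_neg]
  rw [h, Real.exp_add, Real.exp_sum, Real.exp_sum, Finset.prod_mul_distrib,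
    Finset.prod_mul_distrib, massCoeff]
  ring

lemma gradH_apply (n j : ℕ) (m : Fin n → ℝ) (x : Fin n → ℝ) (i : Fin n) :
    gradH n j m x i = ∑ p ∈ interlacingPairs n j,
      massCoeff m p * expo p i * Real.exp (∑ k, expo p k * x k) := by
  have hL : ∀ p : Finset (Fin n) × Finset (Fin n),
      HasFDerivAt (fun x : Fin n → ℝ => ∑ k, expo p k * x k)
        (∑ k, expo p k • (ContinuousLinearMap.proj k : (Fin n → ℝ) →L[ℝ] ℝ)) x := fun p =>
    HasFDerivAt.fun_sum fun k _ => (hasFDerivAt_apply k x).const_mul (expo p k)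
  have hH : HasFDerivAt (Hfun n j m) (∑ p ∈ interlacingPairs n j,
      massCoeff m p • (Real.exp (∑ k, expo p k * x k) •
        ∑ k, expo p k • (ContinuousLinearMap.proj k : (Fin n → ℝ) →L[ℝ] ℝ))) x := by
    rw [show Hfun n j m = _ from funext (Hfun_eq_sum_exp n j m)]
    exact HasFDerivAt.fun_sum fun p _ => ((hL p).exp).const_mul (massCoeff m p)
  rw [gradH, hH.fderiv]
  simp only [_root_.sum_apply, smul_apply, smul_eq_mul,
    ContinuousLinearMap.proj_apply, Pi.single_apply, mul_ite, mul_one, mul_zero,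
    Finset.sum_ite_eq', Finset.mem_univ, if_true]
  exact Finset.sum_congr rfl fun p _ => by ring

lemma analyticOnNhd_gradH (n j : ℕ) (m : Fin n → ℝ) (i : Fin n) :
    AnalyticOnNhd ℝ (fun x => gradH n j m x i) Set.univ := by
  intro x _
  simp only [gradH_apply]
  refine Finset.analyticAt_fun_sum _ fun p _ => analyticAt_const.mul (AnalyticAt.rexp ?_)
  exact Finset.analyticAt_fun_sum _ fun k _ => analyticAt_const.mul
    ((ContinuousLinearMap.proj k : (Fin n → ℝ) →L[ℝ] ℝ).analyticAt x)

lemma Interlaces.disjoint {n : ℕ} {I J : Finset (Fin n)} (hcard : I.card = J.card)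
    (h : Interlaces I J) : Disjoint I J := by
  rw [Finset.disjoint_left]
  intro k hI hJ
  obtain ⟨⟨a, ha⟩, hka⟩ : k ∈ Set.range (I.orderEmbOfFin rfl) := by simpa using hI
  obtain ⟨⟨b, hb⟩, hkb⟩ : k ∈ Set.range (J.orderEmbOfFin rfl) := by simpa using hJ
  rcases le_or_gt a b with hab | hab
  · have h1 := h.1 b (by omega) hb
    have h2 : I.orderEmbOfFin rfl ⟨a, ha⟩ ≤ I.orderEmbOfFin rfl ⟨b, by omega⟩ :=
      (I.orderEmbOfFin rfl).monotone (by simpa using hab)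
    exact absurd (h2.trans_lt h1) (by simp [elt, hka, hkb])
  · have h1 := h.2 b hb (by omega)
    have h2 : I.orderEmbOfFin rfl ⟨b + 1, by omega⟩ ≤ I.orderEmbOfFin rfl ⟨a, ha⟩ :=
      (I.orderEmbOfFin rfl).monotone (by simpa using hab)
    exact absurd (h1.trans_le h2) (by simp [elt, hka, hkb])

lemma elt_image_univ {n N : ℕ} {f : Fin N → Fin n} (hf : StrictMono f) (l : ℕ)
    (h : l < (univ.image f).card) (hl : l < N) : elt (univ.image f) l h = f ⟨l, hl⟩ := by
  have hc : (univ.image f).card = N := by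
    rw [Finset.card_image_of_injective _ hf.injective, Finset.card_fin]
  have key := Finset.orderEmbOfFin_unique (s := univ.image f) rfl (f := f ∘ Fin.cast hc)
    (fun x => by simp) (hf.comp (Fin.cast_strictMono hc))
  exact (congrFun key ⟨l, h⟩).symm

/-- The pair `({0,2,…,2j-2}, {1,3,…,2j-1})` (0-based). -/
noncomputable def leadingPair (n j : ℕ) : Finset (Fin n) × Finset (Fin n) :=
  (univ.filter fun k => (k : ℕ) % 2 = 0 ∧ (k : ℕ) < 2 * j,
    univ.filter fun k => (k : ℕ) % 2 = 1 ∧ (k : ℕ) < 2 * j)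

lemma leadingPair_mem {n j : ℕ} (h : 2 * j ≤ n) : leadingPair n j ∈ interlacingPairs n j := by
  let f : Fin j → Fin n := fun l => ⟨2 * l, by omega⟩
  let g : Fin j → Fin n := fun l => ⟨2 * l + 1, by omega⟩
  have hf : StrictMono f := fun a b hab => by
    have : (a : ℕ) < b := hab
    simp only [f, Fin.mk_lt_mk]; omega
  have hg : StrictMono g := fun a b hab => by
    have : (a : ℕ) < b := hab
    simp only [g, Fin.mk_lt_mk]; omega
  have h1 : (leadingPair n j).1 = univ.image f := by
    ext k
    simp only [leadingPair, mem_filter, mem_univ, true_and, mem_image, f]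
    constructor
    · rintro ⟨h1, h2⟩
      exact ⟨⟨k / 2, by omega⟩, Fin.ext (by simp only; omega)⟩
    · rintro ⟨l, rfl⟩
      simp only; omega
  have h2 : (leadingPair n j).2 = univ.image g := by
    ext k
    simp only [leadingPair, mem_filter, mem_univ, true_and, mem_image, g]
    constructor
    · rintro ⟨h1, h2⟩
      exact ⟨⟨k / 2, by omega⟩, Fin.ext (by simp only; omega)⟩
    · rintro ⟨l, rfl⟩
      simp only; omega
  have c1 : (univ.image f).card = j := by
    rw [Finset.card_image_of_injective _ hf.injective, Finset.card_fin]
  have c2 : (univ.image g).card = j := by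
    rw [Finset.card_image_of_injective _ hg.injective, Finset.card_fin]
  simp only [interlacingPairs, mem_filter, mem_univ, true_and]
  rw [h1, h2]
  refine ⟨c1, c2, fun l hI hJ => ?_, fun l hJ hI => ?_⟩
  · rw [elt_image_univ hf l hI (by omega), elt_image_univ hg l hJ (by omega)]
    simp [f, g]
  · rw [elt_image_univ hf _ hI (by omega), elt_image_univ hg l hJ (by omega)]
    simp only [f, g, Fin.mk_lt_mk]; omega

/-- A direction in which the monomial of `leadingPair` dominates all the others. -/
noncomputable def leadingDir (n : ℕ) (k : Fin n) : ℝ :=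
  if (k : ℕ) % 2 = 0 then (n : ℝ) - (k : ℕ) else -((n : ℝ) - (k : ℕ))

lemma sum_indicator_eq {n j : ℕ} {p : Finset (Fin n) × Finset (Fin n)}
    (hp : p ∈ interlacingPairs n j) :
    ∑ k, ((if k ∈ p.1 then 1 else 0) + (if k ∈ p.2 then 1 else 0) : ℝ) = 2 * j := by
  simp only [interlacingPairs, mem_filter, mem_univ, true_and] at hp
  simp [Finset.sum_add_distrib, hp.1, hp.2.1, two_mul]

lemma sum_expo_lt_leading {n j : ℕ} (h : 2 * j ≤ n) {p : Finset (Fin n) × Finset (Fin n)}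
    (hp : p ∈ interlacingPairs n j) (hne : p ≠ leadingPair n j) :
    ∑ k, expo p k * leadingDir n k < ∑ k, expo (leadingPair n j) k * leadingDir n k := by
  have hdisj : Disjoint p.1 p.2 := by
    simp only [interlacingPairs, mem_filter, mem_univ, true_and] at hp
    exact hp.2.2.disjoint (hp.1.trans hp.2.1.symm)
  set c : ℝ := (n : ℝ) - 2 * j + 1 / 2 with hc
  let ψ : Finset (Fin n) × Finset (Fin n) → Fin n → ℝ := fun q k =>
    expo q k * leadingDir n k - c * ((if k ∈ q.1 then 1 else 0) + (if k ∈ q.2 then 1 else 0))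
  have hψ : ∀ q ∈ interlacingPairs n j,
      ∑ k, ψ q k = ∑ k, expo q k * leadingDir n k - c * (2 * j) := fun q hq => by
    simp only [ψ]
    rw [Finset.sum_sub_distrib, ← Finset.mul_sum, sum_indicator_eq hq]
  have key : ∀ k, ψ p k < ψ (leadingPair n j) k ∨ ψ p k = ψ (leadingPair n j) k ∧
      ((k ∈ p.1 ↔ k ∈ (leadingPair n j).1) ∧ (k ∈ p.2 ↔ k ∈ (leadingPair n j).2)) := by
    intro k
    have hk : ((k : ℕ) : ℝ) + 1 ≤ n := by exact_mod_cast k.2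
    have hj : (2 : ℝ) * j ≤ n := by exact_mod_cast h
    have hd : k ∈ p.1 ∧ k ∉ p.2 ∨ k ∉ p.1 ∧ k ∈ p.2 ∨ k ∉ p.1 ∧ k ∉ p.2 := by
      have : k ∈ p.1 → k ∉ p.2 := fun hk1 => Finset.disjoint_left.1 hdisj hk1
      tauto
    have hlt : (k : ℕ) < 2 * j ∧ ((k : ℕ) : ℝ) + 1 ≤ 2 * j ∨
        ¬ (k : ℕ) < 2 * j ∧ (2 : ℝ) * j ≤ (k : ℕ) := by
      rcases lt_or_ge (k : ℕ) (2 * j) with h1 | h1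
      · exact Or.inl ⟨h1, by exact_mod_cast h1⟩
      · exact Or.inr ⟨by omega, by exact_mod_cast h1⟩
    have hm1 : k ∈ (leadingPair n j).1 ↔ (k : ℕ) % 2 = 0 ∧ (k : ℕ) < 2 * j := by
      simp [leadingPair]
    have hm2 : k ∈ (leadingPair n j).2 ↔ (k : ℕ) % 2 = 1 ∧ (k : ℕ) < 2 * j := by
      simp [leadingPair]
    simp only [ψ, expo, leadingDir, hm1, hm2, hc]
    rcases Nat.mod_two_eq_zero_or_one (k : ℕ) with h0 | h0 <;>
    rcases hlt with ⟨h1, h2⟩ | ⟨h1, h2⟩ <;>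
    rcases hd with ⟨hI, hJ⟩ | ⟨hI, hJ⟩ | ⟨hI, hJ⟩ <;>
    first
      | (simp only [h0, h1, hI, hJ]; norm_num; done)
      | (left; simp only [h0, h1, hI, hJ]; norm_num; linarith)
  have hlt : ∑ k, ψ p k < ∑ k, ψ (leadingPair n j) k := by
    refine Finset.sum_lt_sum (fun k _ => (key k).elim le_of_lt fun hh => hh.1.le) ?_
    by_contra! hcon
    refine hne (Prod.ext (Finset.ext fun k => ?_) (Finset.ext fun k => ?_))
    · exact ((key k).resolve_left (hcon k (mem_univ k)).not_gt).2.1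
    · exact ((key k).resolve_left (hcon k (mem_univ k)).not_gt).2.2
  rw [hψ p hp, hψ _ (leadingPair_mem h)] at hlt
  linarith

lemma tendsto_normalized_gradH {n j : ℕ} (h : 2 * j ≤ n) {m : Fin n → ℝ} (hm : ∀ i, 0 < m i)
    (i : Fin n) :
    Filter.Tendsto (fun s : ℝ => (massCoeff m (leadingPair n j) *
        Real.exp (s * ∑ k, expo (leadingPair n j) k * leadingDir n k))⁻¹ *
          gradH n j m (s • leadingDir n) i)
      Filter.atTop (nhds (expo (leadingPair n j) i)) := by
  set p₀ := leadingPair n j with hp₀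
  have hC : massCoeff m p₀ ≠ 0 :=
    (mul_pos (Finset.prod_pos fun i _ => hm i) (Finset.prod_pos fun i _ => hm i)).ne'
  have hsum : expo p₀ i = ∑ p ∈ interlacingPairs n j, if p = p₀ then expo p₀ i else 0 := by
    rw [Finset.sum_ite_eq', if_pos (leadingPair_mem h)]
  have hfun : (fun s : ℝ => (massCoeff m p₀ *
        Real.exp (s * ∑ k, expo p₀ k * leadingDir n k))⁻¹ * gradH n j m (s • leadingDir n) i) =
      fun s => ∑ p ∈ interlacingPairs n j, (massCoeff m p₀)⁻¹ * massCoeff m p * expo p i *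
        Real.exp (s * (∑ k, expo p k * leadingDir n k - ∑ k, expo p₀ k * leadingDir n k)) := by
    funext s
    rw [gradH_apply, Finset.mul_sum]
    refine Finset.sum_congr rfl fun p _ => ?_
    have hx : ∑ k, expo p k * (s • leadingDir n) k = s * ∑ k, expo p k * leadingDir n k := by
      rw [Finset.mul_sum]
      exact Finset.sum_congr rfl fun k _ => by simp only [Pi.smul_apply, smul_eq_mul]; ring
    rw [hx, mul_sub, Real.exp_sub, mul_inv]
    ring
  rw [hfun, hsum]
  refine tendsto_finsetSum _ fun p hp => ?_
  split_ifs with hpp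
  · subst hpp
    simp [inv_mul_cancel₀ hC]
  · have hneg := sub_neg.2 (sum_expo_lt_leading h hp hpp)
    have := (Real.tendsto_exp_atBot.comp
      (Filter.tendsto_id.atTop_mul_const_of_neg hneg)).const_mul
        ((massCoeff m p₀)⁻¹ * massCoeff m p * expo p i)
    simpa using this

/-- The minor of the Jacobian of `(H_1, …, H_K)` in the variables `x_0, x_2, …, x_{2K-2}`. -/
noncomputable def evenJacobian (K : ℕ) (m x : Fin (2 * K) → ℝ) : Matrix (Fin K) (Fin K) ℝ :=
  Matrix.of fun j l => gradH (2 * K) (j.val + 1) m x ⟨2 * l.val, by omega⟩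

lemma linearIndependent_gradH_of_det_ne_zero {K : ℕ} {m x : Fin (2 * K) → ℝ}
    (h : (evenJacobian K m x).det ≠ 0) :
    LinearIndependent ℝ (fun j : Fin K => gradH (2 * K) (j.val + 1) m x) :=
  LinearIndependent.of_comp
    (LinearMap.funLeft ℝ ℝ fun l : Fin K => (⟨2 * l.val, by omega⟩ : Fin (2 * K)))
    (Matrix.linearIndependent_rows_of_det_ne_zero h)

lemma exists_det_evenJacobian_ne_zero (K : ℕ) {m : Fin (2 * K) → ℝ} (hm : ∀ i, 0 < m i) :
    ∃ x, (evenJacobian K m x).det ≠ 0 := by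
  by_contra! hcon
  let r : Fin K → ℝ → ℝ := fun j s => (massCoeff m (leadingPair (2 * K) (j.val + 1)) *
    Real.exp (s * ∑ k, expo (leadingPair (2 * K) (j.val + 1)) k * leadingDir (2 * K) k))⁻¹
  let T : Matrix (Fin K) (Fin K) ℝ := Matrix.of fun j l =>
    expo (leadingPair (2 * K) (j.val + 1)) ⟨2 * l.val, by omega⟩
  have hT : T.det = 1 := by
    have hlow : T.IsLowerTriangular := by
      intro j l hjl
      have : (j : ℕ) < l := hjl
      simp only [T, Matrix.of_apply, expo, leadingPair, mem_filter, mem_univ, true_and]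
      rw [if_neg (by omega), if_neg (by omega), sub_zero]
    rw [Matrix.det_of_isLowerTriangular _ hlow]
    refine Finset.prod_eq_one fun j _ => ?_
    simp only [T, Matrix.of_apply, expo, leadingPair, mem_filter, mem_univ, true_and]
    rw [if_pos (by omega), if_neg (by omega), sub_zero]
  have hlim : Filter.Tendsto (fun s : ℝ => (Matrix.of fun j l =>
      r j s * evenJacobian K m (s • leadingDir (2 * K)) j l).det) Filter.atTop (nhds T.det) := by
    refine ((continuous_id.matrix_det).tendsto T).comp ?_
    refine tendsto_pi_nhds.2 fun j => tendsto_pi_nhds.2 fun l => ?_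
    exact tendsto_normalized_gradH (by omega) hm _
  simp only [Matrix.det_mul_column, hcon, mul_zero, hT] at hlim
  exact zero_ne_one (tendsto_nhds_unique tendsto_const_nhds hlim)

lemma analyticOnNhd_det_evenJacobian (K : ℕ) (m : Fin (2 * K) → ℝ) :
    AnalyticOnNhd ℝ (fun x => (evenJacobian K m x).det) Set.univ := by
  intro x _
  simp only [Matrix.det_apply']
  exact Finset.analyticAt_fun_sum _ fun σ _ => analyticAt_const.mul
    (Finset.analyticAt_fun_prod _ fun i _ => analyticOnNhd_gradH _ _ m _ x trivial)

lemma isOpen_setOf_strictMono (n : ℕ) : IsOpen {x : Fin n → ℝ | StrictMono x} := by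
  simp only [StrictMono, Set.ofPred_forall]
  exact isOpen_iInter_of_finite fun a => isOpen_iInter_of_finite fun b =>
    isOpen_iInter_of_finite fun _ => isOpen_lt (continuous_apply a) (continuous_apply b)

/-- `H_j` for `1 ≤ j ≤ K` is encoded via `j : Fin K ↦ Hfun (2K) (j+1) m`. -/
theorem statement13 (K : ℕ) (hK : 1 ≤ K) (m : Fin (2 * K) → ℝ) (hm : ∀ i, 0 < m i)
    (y : Fin (2 * K) → ℝ) (hy : StrictMono y) :
    y ∈ closure {x : Fin (2 * K) → ℝ | StrictMono x ∧
      LinearIndependent ℝ (fun j : Fin K => gradH (2 * K) (j.val + 1) m x)} := by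
  by_contra hcl
  have hzero : (fun x => (evenJacobian K m x).det) =ᶠ[nhds y] 0 := by
    filter_upwards [isClosed_closure.isOpen_compl.mem_nhds hcl,
      (isOpen_setOf_strictMono (2 * K)).mem_nhds hy] with x hx hmono
    by_contra hdet
    exact hx (subset_closure ⟨hmono, linearIndependent_gradH_of_det_ne_zero hdet⟩)
  obtain ⟨x, hx⟩ := exists_det_evenJacobian_ne_zero K hm
  exact hx ((analyticOnNhd_det_evenJacobian K m).eqOn_zero_of_preconnected_of_eventuallyEq_zero
    isPreconnected_univ (Set.mem_univ y) hzero (Set.mem_univ x))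
end

section
/- Let K ≥ 1 and n = 2K+1, let m_1,…,m_n be real constants, and let x : ℝ → ℝ^n be a differentiable curve such that x_1(t) < x_2(t) < ⋯ < x_n(t) for all t ∈ ℝ and such that for each 1 ≤ j ≤ n and all t, dx_j/dt = 2 Σ_{k≠j} m_j m_k e^{−|x_j(t)−x_k(t)|} + 4 Σ_{1≤i<j<k≤n} m_i m_k e^{−|x_i(t)−x_k(t)|}. Then the function t ↦ H_c(x(t)) is constant, where H_c(x) = Π_{q=1}^{2K+1} m_q e^{(−1)^{q+1} x_q}. -/
open Finset

/-- Indices are 0-based: the paper's `H_c(x) = ∏_{q=1}^{2K+1} m_q e^{(-1)^{q+1} x_q}`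
becomes `∏_{q : Fin (2K+1)} m_q e^{(-1)^q x_q}`. -/
noncomputable def Hc (K : ℕ) (m : Fin (2 * K + 1) → ℝ) (x : Fin (2 * K + 1) → ℝ) : ℝ :=
  ∏ q : Fin (2 * K + 1), m q * Real.exp ((-1 : ℝ) ^ (q : ℕ) * x q)

theorem sum_neg_one_pow_Ioo (a b : ℕ) (h : a < b) :
    (-1 : ℝ) ^ a + (-1 : ℝ) ^ b + 2 * ∑ j ∈ Finset.Ioo a b, (-1 : ℝ) ^ j = 0 := by
  induction b, h using Nat.le_induction with
  | base =>
    have : Finset.Ioo a (a + 1) = ∅ := by ext; simp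
    simp [this, pow_succ]
  | succ b hb ih =>
    have hins : Finset.Ioo a (b + 1) = insert b (Finset.Ioo a b) := by
      ext; simp; omega
    rw [hins, Finset.sum_insert (by simp), pow_succ]
    linarith

theorem Fin.sum_neg_one_pow_between {n : ℕ} {a b : Fin n} (h : a < b) :
    (-1 : ℝ) ^ (a : ℕ) + (-1 : ℝ) ^ (b : ℕ) +
      2 * ∑ j : Fin n, (if a < j ∧ j < b then (-1 : ℝ) ^ (j : ℕ) else 0) = 0 := by
  have hmain := sum_neg_one_pow_Ioo a b h
  rw [← Fin.map_valEmbedding_Ioo, Finset.sum_map] at hmain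
  rw [← Finset.sum_filter]
  refine Eq.trans ?_ hmain
  congr! 3
  ext; simp

theorem sum_erase_symm {n : ℕ} (c : Fin n → ℝ) (W : Fin n → Fin n → ℝ)
    (hW : ∀ i k, W i k = W k i) :
    ∑ j, c j * ∑ k ∈ Finset.univ.erase j, W j k =
      ∑ a, ∑ b, if a < b then (c a + c b) * W a b else 0 := by
  have hsplit : ∀ j, c j * ∑ k ∈ Finset.univ.erase j, W j k =
      ∑ k, (if j < k then c j * W j k else 0) + ∑ k, (if k < j then c j * W k j else 0) := by
    intro j
    rw [Finset.mul_sum, ← Finset.sum_add_distrib, ← Finset.sum_erase Finset.univ (a := j)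
      (f := fun k => (if j < k then c j * W j k else 0) + if k < j then c j * W k j else 0)
      (by simp)]
    refine Finset.sum_congr rfl fun k hk => ?_
    rcases lt_or_gt_of_ne (Finset.ne_of_mem_erase hk) with h | h
    · simp [h, h.not_gt, hW j k]
    · simp [h, h.not_gt]
  rw [Finset.sum_congr rfl fun j _ => hsplit j, Finset.sum_add_distrib,
    Finset.sum_comm (f := fun j k => if k < j then c j * W k j else 0),
    ← Finset.sum_add_distrib]
  refine Finset.sum_congr rfl fun a _ => ?_
  rw [← Finset.sum_add_distrib]
  refine Finset.sum_congr rfl fun b _ => ?_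
  split_ifs <;> ring

theorem sum_alternating_velocity_eq_zero {n : ℕ} (W : Fin n → Fin n → ℝ)
    (hW : ∀ i k, W i k = W k i) :
    ∑ j : Fin n, (-1 : ℝ) ^ (j : ℕ) * (2 * ∑ k ∈ Finset.univ.erase j, W j k +
      4 * ∑ i : Fin n, ∑ k : Fin n, if i < j ∧ j < k then W i k else 0) = 0 := by
  have hfirst := sum_erase_symm (fun j : Fin n => (-1 : ℝ) ^ (j : ℕ)) W hW
  have hsecond : ∑ j : Fin n, (-1 : ℝ) ^ (j : ℕ) *
      (∑ i : Fin n, ∑ k : Fin n, if i < j ∧ j < k then W i k else 0) =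
      ∑ a, ∑ b, (∑ j : Fin n, if a < j ∧ j < b then (-1 : ℝ) ^ (j : ℕ) else 0) * W a b := by
    simp_rw [Finset.mul_sum, Finset.sum_mul]
    rw [Finset.sum_comm]
    refine Finset.sum_congr rfl fun a _ => ?_
    rw [Finset.sum_comm]
    refine Finset.sum_congr rfl fun b _ => Finset.sum_congr rfl fun j _ => ?_
    split_ifs <;> simp
  calc _ = 2 * ∑ j : Fin n, (-1 : ℝ) ^ (j : ℕ) * ∑ k ∈ Finset.univ.erase j, W j k +
        4 * ∑ j : Fin n, (-1 : ℝ) ^ (j : ℕ) *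
          (∑ i : Fin n, ∑ k : Fin n, if i < j ∧ j < k then W i k else 0) := by
        rw [Finset.mul_sum, Finset.mul_sum, ← Finset.sum_add_distrib]
        exact Finset.sum_congr rfl fun j _ => by ring
    _ = 0 := by
        rw [hfirst, hsecond]
        simp_rw [Finset.mul_sum, ← Finset.sum_add_distrib]
        refine Finset.sum_eq_zero fun a _ => Finset.sum_eq_zero fun b _ => ?_
        by_cases h : a < b
        · rw [if_pos h]
          linear_combination 2 * W a b * Fin.sum_neg_one_pow_between h
        · have hz : ∀ j : Fin n, ¬ (a < j ∧ j < b) := fun j hj => h (hj.1.trans hj.2)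
          simp [h, hz]

theorem Hc_eq (K : ℕ) (m x : Fin (2 * K + 1) → ℝ) :
    Hc K m x = (∏ q, m q) * Real.exp (∑ q : Fin (2 * K + 1), (-1 : ℝ) ^ (q : ℕ) * x q) := by
  rw [Hc, Finset.prod_mul_distrib, Real.exp_sum]

theorem statement15 (K : ℕ) (hK : 1 ≤ K) (m : Fin (2 * K + 1) → ℝ)
    (x : ℝ → Fin (2 * K + 1) → ℝ)
    (hord : ∀ t : ℝ, StrictMono (x t))
    (hode : ∀ (j : Fin (2 * K + 1)) (t : ℝ),
      HasDerivAt (fun s => x s j)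
        (2 * ∑ k ∈ Finset.univ.erase j, m j * m k * Real.exp (-|x t j - x t k|) +
         4 * ∑ i : Fin (2 * K + 1), ∑ k : Fin (2 * K + 1),
            if i < j ∧ j < k then m i * m k * Real.exp (-|x t i - x t k|) else 0) t)
    (t s : ℝ) :
    Hc K m (x t) = Hc K m (x s) := by
  have hderiv : ∀ r, HasDerivAt
      (fun s => ∑ q : Fin (2 * K + 1), (-1 : ℝ) ^ (q : ℕ) * x s q) 0 r := by
    intro r
    rw [← sum_alternating_velocity_eq_zero
      (fun i k => m i * m k * Real.exp (-|x r i - x r k|))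
      (fun i k => by rw [abs_sub_comm, mul_comm (m i)])]
    exact HasDerivAt.fun_sum fun q _ => (hode q r).const_mul _
  rw [Hc_eq, Hc_eq, is_const_of_deriv_eq_zero
    (fun r => (hderiv r).differentiableAt) (fun r => (hderiv r).deriv) t s]
end

section
/- Let n ≥ 2, let m_1,…,m_n be real constants, and let x : ℝ → ℝ^n be a differentiable curve such that x_1(t) < x_2(t) < ⋯ < x_n(t) for all t ∈ ℝ and such that for each 1 ≤ j ≤ n and all t, dx_j/dt = 2 Σ_{k≠j} m_j m_k e^{−|x_j(t)−x_k(t)|} + 4 Σ_{1≤i<j<k≤n} m_i m_k e^{−|x_i(t)−x_k(t)|}. Then the function t ↦ h(x(t)) = Σ_{i,k=1}^n m_i m_k e^{−|x_i(t)−x_k(t)|} is constant; that is, the squared H¹ norm of the peakon profile u(·,t) = Σ_j m_j e^{−|·−x_j(t)|} is preserved by the conservative peakon flow. -/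
open Finset

/-- A telescoping identity for partial sums from the left and from the right. -/
lemma sum_sub_mul_add_partial_sums_eq_zero {n : ℕ} (a b : Fin n → ℝ) :
    ∑ j, (a j * (∑ k, if j < k then b k else 0) - b j * (∑ i, if i < j then a i else 0)) *
      (a j * (∑ k, if j < k then b k else 0) + b j * (∑ i, if i < j then a i else 0) +
        2 * ((∑ i, if i < j then a i else 0) * (∑ k, if j < k then b k else 0))) = 0 := by
  set A : ℕ → ℝ := fun p => ∑ i : Fin n, if (i : ℕ) < p then a i else 0 with hA
  set B : ℕ → ℝ := fun p => ∑ i : Fin n, if p ≤ (i : ℕ) then b i else 0 with hB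
  have hL (j : Fin n) : (∑ i, if i < j then a i else 0) = A j := rfl
  have hR (j : Fin n) : (∑ k, if j < k then b k else 0) = B (j + 1) := rfl
  have hA_succ (j : Fin n) : A (j + 1) = A j + a j := by
    have h : a j = ∑ i, if i = j then a i else 0 := by simp
    rw [h, hA, ← Finset.sum_add_distrib]
    refine Finset.sum_congr rfl fun i _ => ?_
    rcases lt_trichotomy i j with h | h | h <;> grind
  have hB_succ (j : Fin n) : B j = b j + B (j + 1) := by
    have h : b j = ∑ i, if i = j then b i else 0 := by simp
    rw [h, hB, ← Finset.sum_add_distrib]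
    refine Finset.sum_congr rfl fun i _ => ?_
    rcases lt_trichotomy i j with h | h | h <;> grind
  have hA_zero : A 0 = 0 := by simp [hA]
  have hB_top : B n = 0 := Finset.sum_eq_zero fun i _ => if_neg i.isLt.not_ge
  calc _ = ∑ j : Fin n, (A (j + 1) ^ 2 * B (j + 1) ^ 2 - A j ^ 2 * B j ^ 2) := by
        refine Finset.sum_congr rfl fun j _ => ?_
        rw [hL, hR, hA_succ, hB_succ j]
        ring
    _ = ∑ p ∈ range n, (A (p + 1) ^ 2 * B (p + 1) ^ 2 - A p ^ 2 * B p ^ 2) :=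
        Fin.sum_univ_eq_sum_range
          (fun p => A (p + 1) ^ 2 * B (p + 1) ^ 2 - A p ^ 2 * B p ^ 2) n
    _ = 0 := by
        rw [Finset.sum_range_sub (fun p => A p ^ 2 * B p ^ 2), hA_zero, hB_top]
        ring

lemma exp_neg_abs_sub_of_le {u v : ℝ} (h : u ≤ v) :
    Real.exp (-|u - v|) = Real.exp u * Real.exp (-v) := by
  rw [abs_of_nonpos (sub_nonpos.2 h), ← Real.exp_add]
  ring_nf

lemma exp_neg_abs_sub_of_ge {u v : ℝ} (h : v ≤ u) :
    Real.exp (-|u - v|) = Real.exp (-u) * Real.exp v := by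
  rw [abs_sub_comm, exp_neg_abs_sub_of_le h, mul_comm]

/-- The derivative of the peakon energy along a curve of strictly ordered configurations. -/
lemma hasDerivAt_sum_mul_exp_neg_abs_sub {n : ℕ} (m : Fin n → ℝ) {x : ℝ → Fin n → ℝ}
    {v : Fin n → ℝ} {t : ℝ} (hord : ∀ t, StrictMono (x t))
    (hx : ∀ j, HasDerivAt (fun s => x s j) (v j) t) :
    HasDerivAt (fun s => ∑ i, ∑ k, m i * m k * Real.exp (-|x s i - x s k|))
      (2 * ∑ j, (m j * Real.exp (x t j) * (∑ k, if j < k then m k * Real.exp (-x t k) else 0) -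
        m j * Real.exp (-x t j) * (∑ i, if i < j then m i * Real.exp (x t i) else 0)) * v j)
      t := by
  set F : Fin n → Fin n → ℝ := fun i k =>
    (m i * Real.exp (x t i) * if i < k then m k * Real.exp (-x t k) else 0) -
      m i * Real.exp (-x t i) * if k < i then m k * Real.exp (x t k) else 0 with hF
  have hFanti (i k : Fin n) : F k i = -F i k := by
    simp only [hF]
    split_ifs <;> ring
  have hterm (i k : Fin n) : HasDerivAt (fun s => m i * m k * Real.exp (-|x s i - x s k|))
      (F i k * v i + F k i * v k) t := by
    rcases lt_trichotomy i k with h | rfl | h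
    · have hfun : (fun s => m i * m k * Real.exp (-|x s i - x s k|)) =
          fun s => m i * m k * (Real.exp (x s i) * Real.exp (-x s k)) := by
        funext s
        rw [exp_neg_abs_sub_of_le (hord s h).le]
      rw [hfun]
      refine (((hx i).exp.fun_mul (hx k).fun_neg.exp).const_mul (m i * m k)).congr_deriv ?_
      simp only [hF, h, h.not_gt, if_true, if_false]
      ring
    · simpa [hF] using hasDerivAt_const t (m i * m i)
    · have hfun : (fun s => m i * m k * Real.exp (-|x s i - x s k|)) =
          fun s => m i * m k * (Real.exp (-x s i) * Real.exp (x s k)) := by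
        funext s
        rw [exp_neg_abs_sub_of_ge (hord s h).le]
      rw [hfun]
      refine (((hx i).fun_neg.exp.fun_mul (hx k).exp).const_mul (m i * m k)).congr_deriv ?_
      simp only [hF, h, h.not_gt, if_true, if_false]
      ring
  refine (HasDerivAt.fun_sum fun i _ =>
    HasDerivAt.fun_sum fun k _ => hterm i k).congr_deriv (Eq.symm ?_)
  have hrow (j : Fin n) :
      (m j * Real.exp (x t j) * (∑ k, if j < k then m k * Real.exp (-x t k) else 0) -
        m j * Real.exp (-x t j) * (∑ i, if i < j then m i * Real.exp (x t i) else 0)) * v j =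
      ∑ k, F j k * v j := by
    rw [← Finset.sum_mul, hF, Finset.sum_sub_distrib, Finset.mul_sum, Finset.mul_sum]
  simp only [hrow, Finset.sum_add_distrib]
  rw [Finset.sum_comm (f := fun i k => F k i * v k), two_mul]

/-- The conservative peakon velocity in terms of one-sided partial sums. -/
lemma peakon_velocity_eq {n : ℕ} (m y : Fin n → ℝ) (hy : StrictMono y) (j : Fin n) :
    2 * ∑ k ∈ univ.erase j, m j * m k * Real.exp (-|y j - y k|) +
      4 * ∑ i, ∑ k, (if i < j ∧ j < k then m i * m k * Real.exp (-|y i - y k|) else 0) =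
    2 * (m j * Real.exp (y j) * (∑ k, if j < k then m k * Real.exp (-y k) else 0) +
      m j * Real.exp (-y j) * (∑ i, if i < j then m i * Real.exp (y i) else 0) +
      2 * ((∑ i, if i < j then m i * Real.exp (y i) else 0) *
        (∑ k, if j < k then m k * Real.exp (-y k) else 0))) := by
  have hpair : ∑ k ∈ univ.erase j, m j * m k * Real.exp (-|y j - y k|) =
      m j * Real.exp (y j) * (∑ k, if j < k then m k * Real.exp (-y k) else 0) +
      m j * Real.exp (-y j) * (∑ i, if i < j then m i * Real.exp (y i) else 0) := by
    rw [Finset.mul_sum, Finset.mul_sum, ← Finset.sum_add_distrib,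
      ← Finset.sum_erase (a := j) univ (by simp)]
    refine Finset.sum_congr rfl fun k hk => ?_
    rcases lt_or_gt_of_ne (Finset.ne_of_mem_erase hk) with h | h
    · rw [exp_neg_abs_sub_of_ge (hy h).le, if_neg h.not_gt, if_pos h]
      ring
    · rw [exp_neg_abs_sub_of_le (hy h).le, if_pos h, if_neg h.not_gt]
      ring
  have htriple : ∑ i, ∑ k,
        (if i < j ∧ j < k then m i * m k * Real.exp (-|y i - y k|) else 0) =
      (∑ i, if i < j then m i * Real.exp (y i) else 0) *
        (∑ k, if j < k then m k * Real.exp (-y k) else 0) := by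
    rw [Finset.sum_mul_sum]
    refine Finset.sum_congr rfl fun i _ => Finset.sum_congr rfl fun k _ => ?_
    by_cases hi : i < j <;> by_cases hk : j < k <;> simp only [hi, hk, and_self, and_true,
      and_false, if_true, if_false, mul_zero, zero_mul]
    rw [exp_neg_abs_sub_of_le (hy (hi.trans hk)).le]
    ring
  rw [hpair, htriple]
  ring

theorem statement16 (n : ℕ) (hn : 2 ≤ n) (m : Fin n → ℝ) (x : ℝ → Fin n → ℝ)
    (hord : ∀ t : ℝ, StrictMono (x t))
    (hode : ∀ (j : Fin n) (t : ℝ),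
      HasDerivAt (fun s => x s j)
        (2 * ∑ k ∈ Finset.univ.erase j, m j * m k * Real.exp (-|x t j - x t k|) +
         4 * ∑ i : Fin n, ∑ k : Fin n,
            if i < j ∧ j < k then m i * m k * Real.exp (-|x t i - x t k|) else 0) t)
    (t s : ℝ) :
    ∑ i : Fin n, ∑ k : Fin n, m i * m k * Real.exp (-|x t i - x t k|) =
      ∑ i : Fin n, ∑ k : Fin n, m i * m k * Real.exp (-|x s i - x s k|) := by
  have hderiv (r : ℝ) :
      HasDerivAt (fun s => ∑ i, ∑ k, m i * m k * Real.exp (-|x s i - x s k|)) 0 r := by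
    convert hasDerivAt_sum_mul_exp_neg_abs_sub m hord fun j => hode j r using 1
    simp only [peakon_velocity_eq m (x r) (hord r), mul_left_comm _ (2 : ℝ), ← Finset.mul_sum]
    rw [sum_sub_mul_add_partial_sums_eq_zero (fun j => m j * Real.exp (x r j))
      (fun j => m j * Real.exp (-x r j))]
    simp
  exact is_const_of_deriv_eq_zero (fun r => (hderiv r).differentiableAt)
    (fun r => (hderiv r).deriv) t s
end
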